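/- Let q be a 2way-determined query that does not admit a fork-tripath, and let D be a database. Then there exists a partition C₁,…,C_n of D such that: (1) for every i, either C_i contains no tripath of q, or C_i is a clique-database for q; (2) D ⊨ certain(q) if and only if C_i ⊨ certain(q) for some i; (3) for every k ≥ 1, if ∅ ∈ Δ_k(q,C_i) for some i then ∅ ∈ Δ_k(q,D); (4) if H(D,q) admits a matching saturating the set of blocks of D, then for every i, H(C_i,q) admits a matching saturating the set of blocks of C_i. -/

import Mathlib

/- Consistent query answering framework: a single relation symbol of arity `n`
   whose first `l` positions form the primary key. Facts are `Fin n → Elem`,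
   atoms are `Fin n → Var`. -/

namespace CQA

/-- Key-equality: the tuples of the first `l` entries coincide. -/
def keyEq (l : ℕ) {n : ℕ} {α : Type*} (s t : Fin n → α) : Prop :=
  ∀ i : Fin n, (i : ℕ) < l → s i = t i

/-- The set of entries occurring in the first `l` (key) positions of a tuple. -/
def keySet (l : ℕ) {n : ℕ} {α : Type*} (t : Fin n → α) : Set α :=
  {x | ∃ i : Fin n, (i : ℕ) < l ∧ t i = x}

/-- The set of all entries of a tuple. -/
def varsSet {n : ℕ} {α : Type*} (t : Fin n → α) : Set α :=
  Set.range t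

/-- A (two-atom, Boolean, self-join) query `q = AB` is a pair of atoms. -/
abbrev Query (n : ℕ) (Var : Type*) := (Fin n → Var) × (Fin n → Var)

variable {n : ℕ} {Elem Var : Type*}

/-- The pair of facts `(a, b)` matches the two atoms of `q` via a single assignment `μ`. -/
def solPair (q : Query n Var) (a b : Fin n → Elem) : Prop :=
  ∃ μ : Var → Elem, (∀ i, μ (q.1 i) = a i) ∧ (∀ i, μ (q.2 i) = b i)

/-- `D ⊨ q(ab)` : `(a,b)` is a solution to `q` in `D`. -/
def Sol (q : Query n Var) (D : Set (Fin n → Elem)) (a b : Fin n → Elem) : Prop :=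
  a ∈ D ∧ b ∈ D ∧ solPair q a b

/-- `D ⊨ q{ab}` : `(a,b)` or `(b,a)` is a solution to `q` in `D`. -/
def SolSym (q : Query n Var) (D : Set (Fin n → Elem)) (a b : Fin n → Elem) : Prop :=
  Sol q D a b ∨ Sol q D b a

/-- The set `q(D)` of solutions to `q` in `D`. -/
def solSet (q : Query n Var) (D : Set (Fin n → Elem)) :
    Set ((Fin n → Elem) × (Fin n → Elem)) :=
  {p | Sol q D p.1 p.2}

/-- `D ⊨ q` : some solution to `q` exists in `D`. -/
def Sat (q : Query n Var) (D : Set (Fin n → Elem)) : Prop :=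
  ∃ a b, Sol q D a b

/-- A database is consistent if it contains no two distinct key-equal facts. -/
def Consistent (l : ℕ) (D : Set (Fin n → Elem)) : Prop :=
  ∀ a ∈ D, ∀ b ∈ D, keyEq l a b → a = b

/-- `r` is a repair of `D` : a maximal consistent subset of `D`. -/
def Repair (l : ℕ) (D r : Set (Fin n → Elem)) : Prop :=
  r ⊆ D ∧ Consistent l r ∧ ∀ s, r ⊆ s → s ⊆ D → Consistent l s → s = r

/-- `D ⊨ certain(q)` : all repairs of `D` satisfy `q`. -/
def Certain (l : ℕ) (q : Query n Var) (D : Set (Fin n → Elem)) : Prop :=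
  ∀ r, Repair l D r → Sat q r

/-- The block of the fact `a` in `D`: all facts of `D` key-equal to `a`. -/
def Block (l : ℕ) (D : Set (Fin n → Elem)) (a : Fin n → Elem) : Set (Fin n → Elem) :=
  {b ∈ D | keyEq l a b}

/-- A `k`-set of `D`: at most `k` facts of `D`, at most one from each block. -/
def kSet (l k : ℕ) (D S : Set (Fin n → Elem)) : Prop :=
  S ⊆ D ∧ S.Finite ∧ S.ncard ≤ k ∧ Consistent l S

/-- A collection `𝒮` of sets of facts is closed under the two rules defining `Δ_k(q,D)`:
  (i) every `k`-set satisfying `q` is in `𝒮`, and (ii) if for a `k`-set `S` there is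
  a block of `D` each of whose facts `u` admits a subset `S' ⊆ S ∪ {u}` that is a
  `k`-set belonging to `𝒮`, then `S ∈ 𝒮`. -/
def DeltaClosed (l k : ℕ) (q : Query n Var) (D : Set (Fin n → Elem))
    (𝒮 : Set (Set (Fin n → Elem))) : Prop :=
  (∀ S, kSet l k D S → Sat q S → S ∈ 𝒮) ∧
  (∀ S, kSet l k D S → (∃ x ∈ D, ∀ u ∈ D, keyEq l x u →
      ∃ S', S' ⊆ S ∪ {u} ∧ kSet l k D S' ∧ S' ∈ 𝒮) → S ∈ 𝒮)

/-- `Δ_k(q,D)`: the least collection of `k`-sets of `D` closed under the two rules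
(the intersection of all closed collections). -/
def Delta (l k : ℕ) (q : Query n Var) (D : Set (Fin n → Elem)) :
    Set (Set (Fin n → Elem)) :=
  ⋂₀ {𝒮 | DeltaClosed l k q D 𝒮}

/-- `q = AB` is 2way-determined. -/
def TwoWayDet (l : ℕ) (q : Query n Var) : Prop :=
  ¬ keySet l q.1 ⊆ keySet l q.2 ∧ ¬ keySet l q.2 ⊆ keySet l q.1 ∧
  keySet l q.1 ⊆ varsSet q.2 ∧ keySet l q.2 ⊆ varsSet q.1

/-- The zig-zag property of a query `q`, relative to databases over `Elem`. -/
def ZigZag (l : ℕ) (q : Query n Var) (Elem : Type*) : Prop :=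
  ∀ D : Set (Fin n → Elem), D.Finite →
    ∀ a b b' c : Fin n → Elem, a ∈ D → b ∈ D → b' ∈ D → c ∈ D →
      ¬ keyEq l a c → a ≠ b → keyEq l b b' →
      Sol q D a b → Sol q D c b' → Sol q D a b'

/-- `rkey(a, r)`: facts of `r` whose key entries are included in those of `a`. -/
def rkey (l : ℕ) (r : Set (Fin n → Elem)) (a : Fin n → Elem) : Set (Fin n → Elem) :=
  {c ∈ r | keySet l c ⊆ keySet l a}

open Classical in
/-- `g(e)`, the set of entries of the tuple `g̅(e)`, for `e` branching with `d, f`. -/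
noncomputable def gSet (l : ℕ) (d e f : Fin n → Elem) : Set Elem :=
  if keySet l d ⊆ keySet l e ∧ ¬ keySet l f ⊆ keySet l e then keySet l d
  else if ¬ keySet l d ⊆ keySet l e ∧ keySet l f ⊆ keySet l e then keySet l f
  else if keySet l d ⊆ keySet l f ∧ keySet l f ⊆ keySet l e then keySet l d
  else if keySet l f ⊆ keySet l d ∧ keySet l d ⊆ keySet l e then keySet l f
  else keySet l e

/-- A tripath of `q`: a database `Θ`, each of whose blocks has at most two facts,
whose blocks (indexed by `Fin m`) are arranged as a rooted tree with exactly one root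
block and exactly two leaf blocks; the root block has the single fact `a(root)`, leaf
blocks have the single fact `b(leaf)`, all other blocks have exactly the two facts
`a(B) ≠ b(B)`; if `B` is the parent of `B'` then `Θ ⊨ q{a(B) b(B')}`; the (unique)
branching block `B` with its two children `B', B''` gives the center `d e f` =
`b(B') a(B) b(B'')` with `(d,e)` and `(e,f)` distinct solutions; and `g(e)` is not
included in the key of the root fact nor of either leaf fact. -/
structure Tripath (l : ℕ) (q : Query n Var) (Θ : Set (Fin n → Elem)) where
  finite : Θ.Finite
  m : ℕ
  blk : Fin m → Set (Fin n → Elem)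
  blk_is_block : ∀ i, ∃ x ∈ Θ, blk i = Block l Θ x
  blk_cover : Θ = ⋃ i, blk i
  blk_inj : Function.Injective blk
  blk_card : ∀ i, (blk i).ncard ≤ 2
  parent : Fin m → Option (Fin m)
  root : Fin m
  parent_root : parent root = none
  parent_ne_root : ∀ i, i ≠ root → ∃ j, parent i = some j
  reach_root : ∀ i, Relation.ReflTransGen (fun x y => parent x = some y) i root
  leaf1 : Fin m
  leaf2 : Fin m
  leaf_ne : leaf1 ≠ leaf2
  leaf1_leaf : ∀ j, parent j ≠ some leaf1
  leaf2_leaf : ∀ j, parent j ≠ some leaf2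
  leaves_eq : ∀ i, (∀ j, parent j ≠ some i) → i = leaf1 ∨ i = leaf2
  aFact : Fin m → (Fin n → Elem)
  bFact : Fin m → (Fin n → Elem)
  root_blk : blk root = {aFact root}
  leaf1_blk : blk leaf1 = {bFact leaf1}
  leaf2_blk : blk leaf2 = {bFact leaf2}
  other_blk : ∀ i, i ≠ root → i ≠ leaf1 → i ≠ leaf2 →
    aFact i ≠ bFact i ∧ blk i = {aFact i, bFact i}
  adj_sol : ∀ i j, parent j = some i → SolSym q Θ (aFact i) (bFact j)
  branch : Fin m
  child1 : Fin m
  child2 : Fin m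
  child_ne : child1 ≠ child2
  parent_child1 : parent child1 = some branch
  parent_child2 : parent child2 = some branch
  center_sol1 : Sol q Θ (bFact child1) (aFact branch)
  center_sol2 : Sol q Θ (aFact branch) (bFact child2)
  center_distinct : (bFact child1, aFact branch) ≠ (aFact branch, bFact child2)
  g_root : ¬ gSet l (bFact child1) (aFact branch) (bFact child2) ⊆ keySet l (aFact root)
  g_leaf1 : ¬ gSet l (bFact child1) (aFact branch) (bFact child2) ⊆ keySet l (bFact leaf1)
  g_leaf2 : ¬ gSet l (bFact child1) (aFact branch) (bFact child2) ⊆ keySet l (bFact leaf2)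

namespace Tripath

variable {l : ℕ} {q : Query n Var} {Θ : Set (Fin n → Elem)}

/-- The fact `d` of the center `def` of a tripath. -/
def dc (T : Tripath l q Θ) : Fin n → Elem := T.bFact T.child1
/-- The fact `e` of the center `def` of a tripath. -/
def ec (T : Tripath l q Θ) : Fin n → Elem := T.aFact T.branch
/-- The fact `f` of the center `def` of a tripath. -/
def fc (T : Tripath l q Θ) : Fin n → Elem := T.bFact T.child2
/-- The root fact `u₀` of a tripath. -/
def u0 (T : Tripath l q Θ) : Fin n → Elem := T.aFact T.root
/-- The leaf fact `u₁` of a tripath. -/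
def u1 (T : Tripath l q Θ) : Fin n → Elem := T.bFact T.leaf1
/-- The leaf fact `u₂` of a tripath. -/
def u2 (T : Tripath l q Θ) : Fin n → Elem := T.bFact T.leaf2

/-- The center of the tripath is a fork (`(f,d)` is not a solution). -/
def IsFork (T : Tripath l q Θ) : Prop := ¬ Sol q Θ T.fc T.dc

/-- The center of the tripath is a triangle (`(f,d)` is a solution). -/
def IsTriangle (T : Tripath l q Θ) : Prop := Sol q Θ T.fc T.dc

/-- Variable-niceness witnessed by the elements `x, y, z`. -/
def VariableNiceWith (T : Tripath l q Θ) (x y z : Elem) : Prop :=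
  x ∈ keySet l T.dc ∧ y ∈ keySet l T.ec ∧ z ∈ keySet l T.fc ∧
  ({x, y, z} : Set Elem) ∩ (keySet l T.u0 ∪ keySet l T.u1 ∪ keySet l T.u2) = ∅

/-- The tripath is variable-nice. -/
def VariableNice (T : Tripath l q Θ) : Prop := ∃ x y z, T.VariableNiceWith x y z

/-- The tripath is solution-nice: the only solutions to `q` in `Θ` are those between a
parent block and a child block, plus possibly `(f, d)`. -/
def SolutionNice (T : Tripath l q Θ) : Prop :=
  ∀ a b, Sol q Θ a b →
    (∃ i j, T.parent j = some i ∧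
      ((a = T.aFact i ∧ b = T.bFact j) ∨ (a = T.bFact j ∧ b = T.aFact i)))
    ∨ (a = T.fc ∧ b = T.dc)

/-- The tripath is nice. -/
def Nice (T : Tripath l q Θ) : Prop :=
  (∃ x y z : Elem, T.VariableNiceWith x y z ∧
    ∃ w ∈ ({x, y, z} : Set Elem),
      ∀ c ∈ Θ, c ≠ T.u0 → c ≠ T.u1 → c ≠ T.u2 → w ∈ keySet l c) ∧
  T.SolutionNice ∧
  (∀ u ∈ ({T.u0, T.u1, T.u2} : Set (Fin n → Elem)),
    ∃ w ∈ keySet l u, ∀ c ∈ Θ, c ≠ u → w ∉ keySet l c)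

end Tripath

/-- `D` contains a tripath of `q`: some subset of `D` is a tripath of `q`. -/
def ContainsTripath (l : ℕ) (q : Query n Var) (D : Set (Fin n → Elem)) : Prop :=
  ∃ Θ ⊆ D, Nonempty (Tripath l q Θ)

/-- `q` admits a fork-tripath (over databases with elements in `Elem`). -/
def AdmitsForkTripath (l : ℕ) (q : Query n Var) (Elem : Type*) : Prop :=
  ∃ D : Set (Fin n → Elem), D.Finite ∧ ∃ Θ ⊆ D, ∃ T : Tripath l q Θ, T.IsFork

/-- `q` admits a triangle-tripath (over databases with elements in `Elem`). -/
def AdmitsTriangleTripath (l : ℕ) (q : Query n Var) (Elem : Type*) : Prop :=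
  ∃ D : Set (Fin n → Elem), D.Finite ∧ ∃ Θ ⊆ D, ∃ T : Tripath l q Θ, T.IsTriangle

/-- `q` admits a tripath (over databases with elements in `Elem`). -/
def AdmitsTripath (l : ℕ) (q : Query n Var) (Elem : Type*) : Prop :=
  ∃ D : Set (Fin n → Elem), D.Finite ∧ ContainsTripath l q D

/-- Edges of the solution graph `G(D,q)`: distinct facts `a, b` of `D` with `D ⊨ q{ab}`. -/
def gEdge (q : Query n Var) (D : Set (Fin n → Elem)) (a b : Fin n → Elem) : Prop :=
  a ≠ b ∧ a ∈ D ∧ b ∈ D ∧ SolSym q D a b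

/-- The connected component of the fact `a` in the solution graph `G(D,q)`. -/
def gComp (q : Query n Var) (D : Set (Fin n → Elem)) (a : Fin n → Elem) :
    Set (Fin n → Elem) :=
  {b ∈ D | Relation.ReflTransGen (gEdge q D) a b}

/-- `C` is a quasi-clique (of the solution graph of `D`): any two non-key-equal facts of
`C` are joined by an edge. -/
def QuasiClique (l : ℕ) (q : Query n Var) (D : Set (Fin n → Elem))
    (C : Set (Fin n → Elem)) : Prop :=
  ∀ a ∈ C, ∀ b ∈ C, ¬ keyEq l a b → SolSym q D a b

open Classical in
/-- `clique(a)`: the connected component of `a` in `G(D,q)` if it is a quasi-clique, and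
`{a}` otherwise. -/
noncomputable def cliqueOf (l : ℕ) (q : Query n Var) (D : Set (Fin n → Elem))
    (a : Fin n → Elem) : Set (Fin n → Elem) :=
  if QuasiClique l q D (gComp q D a) then gComp q D a else {a}

/-- Edges of the bipartite graph `H(D,q)`: between a block `B` of `D` and a set `c` of
the form `clique(y)`, when `B` contains a fact `a ∈ c` with `(a,a)` not a solution. -/
def HEdge (l : ℕ) (q : Query n Var) (D : Set (Fin n → Elem))
    (B c : Set (Fin n → Elem)) : Prop :=
  (∃ x ∈ D, B = Block l D x) ∧ (∃ y ∈ D, c = cliqueOf l q D y) ∧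
  ∃ a ∈ B, a ∈ c ∧ ¬ Sol q D a a

/-- `H(D,q)` admits a matching saturating the set `V₁` of blocks of `D`: an injective
assignment of an `H`-edge to every block. -/
def SaturatingMatching (l : ℕ) (q : Query n Var) (D : Set (Fin n → Elem)) : Prop :=
  ∃ M : Set (Fin n → Elem) → Set (Fin n → Elem),
    (∀ x ∈ D, HEdge l q D (Block l D x) (M (Block l D x))) ∧
    (∀ x ∈ D, ∀ y ∈ D, M (Block l D x) = M (Block l D y) → Block l D x = Block l D y)

/-- `D` is a clique-database for `q`: every connected component of `G(D,q)` is a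
quasi-clique. -/
def CliqueDB (l : ℕ) (q : Query n Var) (D : Set (Fin n → Elem)) : Prop :=
  ∀ a ∈ D, QuasiClique l q D (gComp q D a)

/-- `q` is a clique-query: every database (over `Elem`) is a clique-database for `q`. -/
def CliqueQuery (l : ℕ) (q : Query n Var) (Elem : Type*) : Prop :=
  ∀ D : Set (Fin n → Elem), D.Finite → CliqueDB l q D

/-- One step of `q`-connectedness between (the blocks of) two facts of `D`:
either they are in the same block, or some fact of the block of `x` and some fact
of the block of `y` form a solution. -/
def qConnRel (l : ℕ) (q : Query n Var) (D : Set (Fin n → Elem))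
    (x y : Fin n → Elem) : Prop :=
  keyEq l x y ∨ ∃ a b, a ∈ Block l D x ∧ b ∈ Block l D y ∧ SolSym q D a b

/-- The blocks of `x` and of `y` are `q`-connected in `D`
(reflexive-symmetric-transitive closure). -/
def qConn (l : ℕ) (q : Query n Var) (D : Set (Fin n → Elem))
    (x y : Fin n → Elem) : Prop :=
  Relation.EqvGen (qConnRel l q D) x y

/-- The `q`-connected component of (the block of) the fact `x` in `D`. -/
def qComponent (l : ℕ) (q : Query n Var) (D : Set (Fin n → Elem))
    (x : Fin n → Elem) : Set (Fin n → Elem) :=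
  {y ∈ D | qConn l q D x y}

end CQA

namespace CQA

section builder

variable {n l : ℕ} {Elem Var : Type}

/-- index of the parent block in the tree -/
def bpar (N : ℕ) (x : Fin 3 × Fin (N+1)) : Option (Fin 3 × Fin (N+1)) :=
  if x.1 = 1 then
    (if h : (x.2 : ℕ) < N then some (1, ⟨x.2 + 1, by omega⟩) else none)
  else if (x.2 : ℕ) = 0 then some (1, 0) else some (x.1, ⟨x.2 - 1, by omega⟩)

theorem bpar_eq (N : ℕ) (x y : Fin 3 × Fin (N+1)) :
    bpar N x = some y ↔ (x.1 = 1 ∧ y.1 = 1 ∧ (y.2 : ℕ) = x.2 + 1) ∨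
      (x.1 ≠ 1 ∧ (x.2 : ℕ) = 0 ∧ y.1 = 1 ∧ (y.2 : ℕ) = 0) ∨
      (x.1 ≠ 1 ∧ y.1 = x.1 ∧ (x.2 : ℕ) = y.2 + 1) := by
  obtain ⟨i, t, ht⟩ := x
  obtain ⟨j, u, hu⟩ := y
  unfold bpar
  simp only
  split_ifs with h1 h2 h3
  · simp only [Option.some.injEq, Prod.mk.injEq, Fin.mk.injEq]
    constructor
    · rintro ⟨rfl, rfl⟩; left; exact ⟨h1, rfl, rfl⟩
    · rintro (⟨_, h, h'⟩ | ⟨h, _⟩ | ⟨h, _⟩)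
      · exact ⟨h.symm, h'.symm⟩
      · exact absurd h1 h
      · exact absurd h1 h
  · simp only [false_iff]
    rintro (⟨_, h, h'⟩ | ⟨h, _⟩ | ⟨h, _⟩)
    · omega
    · exact absurd h1 h
    · exact absurd h1 h
  · simp only [Option.some.injEq, Prod.mk.injEq]
    constructor
    · rintro ⟨rfl, h⟩; right; left; refine ⟨h1, h3, rfl, ?_⟩
      have := congrArg Fin.val h; simp at this; omega
    · rintro (⟨h, _⟩ | ⟨_, _, h, h'⟩ | ⟨_, _, h⟩)
      · exact absurd h h1
      · refine ⟨h.symm, ?_⟩; ext; simp; omega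
      · omega
  · simp only [Option.some.injEq, Prod.mk.injEq, Fin.mk.injEq]
    constructor
    · rintro ⟨rfl, h⟩; right; right; exact ⟨h1, rfl, by omega⟩
    · rintro (⟨h, _⟩ | ⟨_, h, _⟩ | ⟨_, h, h'⟩)
      · exact absurd h h1
      · omega
      · exact ⟨h.symm, by omega⟩

theorem keyEq_refl (a : Fin n → Elem) : keyEq l a a := fun _ _ => rfl
theorem keyEq.symm {a b : Fin n → Elem} (h : keyEq l a b) : keyEq l b a := fun i hi => (h i hi).symm
theorem keyEq.trans {a b c : Fin n → Elem} (h : keyEq l a b) (h' : keyEq l b c) : keyEq l a c :=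
  fun i hi => (h i hi).trans (h' i hi)

theorem tripath_builder (q : Query n Var) (N : ℕ)
    (fi fo : Fin 3 → ℕ → Fin n → Elem)
    (H1 : ∀ i t, t < N → keyEq l (fi i t) (fo i t))
    (H1' : ∀ i t, t < N → fo i t ≠ fi i t)
    (H2 : ∀ i i' t t', t ≤ N → t' ≤ N → keyEq l (fi i t) (fi i' t') → i = i' ∧ t = t')
    (H3 : ∀ i t, t < N → solPair q (fo i t) (fi i (t+1)) ∨ solPair q (fi i (t+1)) (fo i t))
    (H4 : solPair q (fi 0 0) (fi 1 0)) (H4' : solPair q (fi 1 0) (fi 2 0))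
    (H4'' : ¬ solPair q (fi 2 0) (fi 0 0))
    (H5 : ∀ i, ¬ gSet l (fi 0 0) (fi 1 0) (fi 2 0) ⊆ keySet l (fi i N)) :
    AdmitsForkTripath l q Elem := by
  classical
  let Θ : Set (Fin n → Elem) := {x | (∃ i t, t ≤ N ∧ x = fi i t) ∨ (∃ i t, t < N ∧ x = fo i t)}
  have hfi : ∀ i t, t ≤ N → fi i t ∈ Θ := fun i t h => Or.inl ⟨i, t, h, rfl⟩
  have hfo : ∀ i t, t < N → fo i t ∈ Θ := fun i t h => Or.inr ⟨i, t, h, rfl⟩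
  have hfin : Θ.Finite := by
    have h1 : ((fun x : Fin 3 × ℕ => fi x.1 x.2) '' (Set.univ ×ˢ Set.Iic N)).Finite :=
      (Set.finite_univ.prod (Set.finite_Iic N)).image _
    have h2 : ((fun x : Fin 3 × ℕ => fo x.1 x.2) '' (Set.univ ×ˢ Set.Iic N)).Finite :=
      (Set.finite_univ.prod (Set.finite_Iic N)).image _
    refine (h1.union h2).subset ?_
    rintro x (⟨i, t, h, rfl⟩ | ⟨i, t, h, rfl⟩)
    · left; exact ⟨(i, t), ⟨trivial, h⟩, rfl⟩
    · right; exact ⟨(i, t), ⟨trivial, h.le⟩, rfl⟩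
  have hblk : ∀ i t, t < N → Block l Θ (fi i t) = {fi i t, fo i t} := by
    intro i t ht
    ext x
    simp only [Block, Set.mem_ofPred_eq, Set.mem_insert_iff, Set.mem_singleton_iff]
    constructor
    · rintro ⟨(⟨j, u, hu, rfl⟩ | ⟨j, u, hu, rfl⟩), hk⟩
      · obtain ⟨rfl, rfl⟩ := H2 _ _ _ _ ht.le hu hk
        left; rfl
      · obtain ⟨rfl, rfl⟩ := H2 _ _ _ _ ht.le hu.le (hk.trans (H1 j u hu).symm)
        right; rfl
    · rintro (rfl | rfl)
      · exact ⟨hfi _ _ ht.le, keyEq_refl _⟩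
      · exact ⟨hfo _ _ ht, H1 _ _ ht⟩
  have hblkN : ∀ i, Block l Θ (fi i N) = {fi i N} := by
    intro i
    ext x
    simp only [Block, Set.mem_ofPred_eq, Set.mem_singleton_iff]
    constructor
    · rintro ⟨(⟨j, u, hu, rfl⟩ | ⟨j, u, hu, rfl⟩), hk⟩
      · obtain ⟨rfl, rfl⟩ := H2 _ _ _ _ le_rfl hu hk
        rfl
      · obtain ⟨rfl, rfl⟩ := H2 _ _ _ _ le_rfl hu.le (hk.trans (H1 j u hu).symm)
        omega
    · rintro rfl
      exact ⟨hfi _ _ le_rfl, keyEq_refl _⟩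
  let e : Fin 3 × Fin (N+1) ≃ Fin (3 * (N+1)) := finProdFinEquiv
  let af : Fin 3 × Fin (N+1) → (Fin n → Elem) := fun x => if x.1 = 1 then fi x.1 x.2 else fo x.1 x.2
  let bf : Fin 3 × Fin (N+1) → (Fin n → Elem) := fun x => if x.1 = 1 then fo x.1 x.2 else fi x.1 x.2
  have hpar : ∀ x y, (bpar N (e.symm x)).map e = some y ↔ bpar N (e.symm x) = some (e.symm y) := by
    intro x y
    rw [Option.map_eq_some_iff]
    constructor
    · rintro ⟨a, h, rfl⟩; simpa using h
    · intro h; exact ⟨_, h, by simp⟩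
  have hreach1 : ∀ k : ℕ, ∀ t : Fin (N+1), (t : ℕ) + k = N → Relation.ReflTransGen
      (fun x y => (bpar N (e.symm x)).map e = some y) (e (1, t)) (e (1, Fin.last N)) := by
    intro k
    induction k with
    | zero =>
      intro t ht
      have : t = Fin.last N := by ext; simpa using ht
      subst this
      exact Relation.ReflTransGen.refl
    | succ k ih =>
      intro t ht
      refine Relation.ReflTransGen.head ?_ (ih ⟨t + 1, by omega⟩ (by simp; omega))
      rw [hpar, bpar_eq]
      left; simp
  have hreach2 : ∀ i : Fin 3, i ≠ 1 → ∀ k : ℕ, ∀ t : Fin (N+1), (t : ℕ) = k → Relation.ReflTransGen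
      (fun x y => (bpar N (e.symm x)).map e = some y) (e (i, t)) (e (1, Fin.last N)) := by
    intro i hi k
    induction k with
    | zero =>
      intro t ht
      refine Relation.ReflTransGen.head ?_ (hreach1 N 0 (by simp))
      rw [hpar, bpar_eq]
      right; left; simp [hi, ht]
    | succ k ih =>
      intro t ht
      refine Relation.ReflTransGen.head ?_ (ih ⟨k, by omega⟩ (by simp))
      rw [hpar, bpar_eq]
      right; right; simp [hi, ht]
  have hblke : ∀ x : Fin 3 × Fin (N+1), (x.2 : ℕ) < N →
      af x ≠ bf x ∧ Block l Θ (fi x.1 x.2) = {af x, bf x} := by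
    intro x hx
    by_cases h : x.1 = 1
    · simp only [af, bf, h, if_true]
      exact ⟨(H1' _ _ hx).symm, hblk _ _ hx⟩
    · simp only [af, bf, h, if_false]
      exact ⟨(H1' _ _ hx), by rw [hblk _ _ hx, Set.pair_comm]⟩
  have T : ∃ T : Tripath l q Θ, T.IsFork := by
    refine ⟨{ finite := hfin
              m := 3 * (N+1)
              blk := fun x => Block l Θ (fi (e.symm x).1 (e.symm x).2)
              blk_is_block := fun x => ⟨_, hfi _ _ (by omega), rfl⟩
              blk_cover := ?_
              blk_inj := ?_
              blk_card := ?_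
              parent := fun x => (bpar N (e.symm x)).map e
              root := e (1, Fin.last N)
              parent_root := by simp [bpar]
              parent_ne_root := ?_
              reach_root := ?_
              leaf1 := e (0, Fin.last N)
              leaf2 := e (2, Fin.last N)
              leaf_ne := by simp
              leaf1_leaf := ?_
              leaf2_leaf := ?_
              leaves_eq := ?_
              aFact := fun x => af (e.symm x)
              bFact := fun x => bf (e.symm x)
              root_blk := by simpa [af] using hblkN 1
              leaf1_blk := by simpa [bf] using hblkN 0
              leaf2_blk := by simpa [bf] using hblkN 2
              other_blk := ?_
              adj_sol := ?_
              branch := e (1, 0)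
              child1 := e (0, 0)
              child2 := e (2, 0)
              child_ne := by simp
              parent_child1 := by rw [hpar, bpar_eq]; simp
              parent_child2 := by rw [hpar, bpar_eq]; simp
              center_sol1 := ?_
              center_sol2 := ?_
              center_distinct := ?_
              g_root := ?_
              g_leaf1 := ?_
              g_leaf2 := ?_ }, ?_⟩
    · ext x
      simp only [Set.mem_iUnion]
      constructor
      · rintro (⟨i, t, h, rfl⟩ | ⟨i, t, h, rfl⟩)
        · exact ⟨e (i, ⟨t, by omega⟩), by simpa using ⟨hfi _ _ h, keyEq_refl _⟩⟩
        · exact ⟨e (i, ⟨t, by omega⟩), by simpa using ⟨hfo _ _ h, H1 _ _ h⟩⟩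
      · rintro ⟨i, h⟩; exact h.1
    · intro x y hxy
      have : fi (e.symm y).1 (e.symm y).2 ∈ Block l Θ (fi (e.symm x).1 (e.symm x).2) := by
        have hxy' : Block l Θ (fi (e.symm x).1 (e.symm x).2) = _ := hxy
        rw [hxy']
        exact ⟨hfi _ _ (by omega), keyEq_refl _⟩
      obtain ⟨h1, h2⟩ := H2 _ _ _ _ (by omega) (by omega) this.2
      apply e.symm.injective
      ext <;> simp_all
    · intro x
      by_cases h : ((e.symm x).2 : ℕ) < N
      · rw [hblk _ _ h]; exact (Set.ncard_insert_le _ _).trans (by simp)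
      · have : ((e.symm x).2 : ℕ) = N := by omega
        rw [this, hblkN]; simp
    · intro x hx
      obtain ⟨⟨i, t⟩, rfl⟩ := e.surjective x
      by_cases hi : i = 1
      · subst hi
        have : (t : ℕ) < N := by
          rcases Nat.lt_or_ge t N with h | h
          · exact h
          · exfalso; apply hx; congr 2; ext; simp; omega
        refine ⟨e (1, ⟨t+1, by omega⟩), ?_⟩
        rw [hpar, bpar_eq]; simp
      · by_cases ht : (t : ℕ) = 0
        · refine ⟨e (1, 0), ?_⟩
          rw [hpar, bpar_eq]; simp [hi, ht]
        · refine ⟨e (i, ⟨t-1, by omega⟩), ?_⟩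
          rw [hpar, bpar_eq]; simp [hi]; omega
    · intro x
      obtain ⟨⟨i, t⟩, rfl⟩ := e.surjective x
      by_cases hi : i = 1
      · subst hi; exact hreach1 (N - t) t (by omega)
      · exact hreach2 i hi t t rfl
    · intro x
      obtain ⟨⟨i, t⟩, rfl⟩ := e.surjective x
      rw [Ne, hpar, bpar_eq]; simp; omega
    · intro x
      obtain ⟨⟨i, t⟩, rfl⟩ := e.surjective x
      rw [Ne, hpar, bpar_eq]; simp; omega
    · intro x hx
      obtain ⟨⟨i, t⟩, rfl⟩ := e.surjective x
      by_cases hi : i = 1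
      · subst hi
        exfalso
        by_cases ht : (t : ℕ) = 0
        · apply hx (e (0, 0)); rw [hpar, bpar_eq]; simp [ht]
        · apply hx (e (1, ⟨t-1, by omega⟩)); rw [hpar, bpar_eq]; simp; omega
      · have ht : ¬ (t : ℕ) < N := by
          intro ht
          apply hx (e (i, ⟨t+1, by omega⟩)); rw [hpar, bpar_eq]; simp [hi]
        have : t = Fin.last N := by ext; simp; omega
        subst this
        fin_cases i
        · left; rfl
        · exact absurd rfl hi
        · right; rfl
    · intro x h0 h1 h2
      obtain ⟨⟨i, t⟩, rfl⟩ := e.surjective x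
      have ht : (t : ℕ) < N := by
        by_contra ht
        have : t = Fin.last N := by ext; simp; omega
        subst this
        fin_cases i
        · exact h1 rfl
        · exact h0 rfl
        · exact h2 rfl
      simpa using hblke (i, t) ht
    · intro x y hxy
      obtain ⟨⟨i, t⟩, rfl⟩ := e.surjective x
      obtain ⟨⟨j, u⟩, rfl⟩ := e.surjective y
      rw [hpar, bpar_eq] at hxy
      simp only [Equiv.symm_apply_apply] at hxy ⊢
      rcases hxy with ⟨rfl, rfl, h⟩ | ⟨hj, hu, rfl, ht⟩ | ⟨hj, rfl, h⟩
      · simp only [af, bf, if_true, h]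
        have hu : (u : ℕ) < N := by omega
        rcases H3 1 u hu with h3 | h3
        · right; exact ⟨hfo _ _ hu, hfi _ _ hu, h3⟩
        · left; exact ⟨hfi _ _ hu, hfo _ _ hu, h3⟩
      · simp only [af, bf, if_true, if_neg hj, ht, hu]
        fin_cases j
        · right; exact ⟨hfi _ _ (by omega), hfi _ _ (by omega), H4⟩
        · exact absurd rfl hj
        · left; exact ⟨hfi _ _ (by omega), hfi _ _ (by omega), H4'⟩
      · simp only [af, bf, if_neg hj, h]
        have ht : (t : ℕ) < N := by omega
        rcases H3 i t ht with h3 | h3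
        · left; exact ⟨hfo _ _ ht, hfi _ _ ht, h3⟩
        · right; exact ⟨hfi _ _ ht, hfo _ _ ht, h3⟩
    · simp only [Equiv.symm_apply_apply]
      exact ⟨hfi _ _ (by simp), hfi _ _ (by simp), by simpa [af, bf] using H4⟩
    · simp only [Equiv.symm_apply_apply]
      exact ⟨hfi _ _ (by simp), hfi _ _ (by simp), by simpa [af, bf] using H4'⟩
    · simp only [Equiv.symm_apply_apply, af, bf]
      intro h
      have h := (Prod.mk.inj h).1
      have := H2 0 1 0 0 (by omega) (by omega) (by
        have h' : fi 0 0 = fi 1 0 := by simpa using h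
        rw [h']; exact keyEq_refl _)
      exact absurd this.1 (by decide)
    · simpa [af, bf] using H5 1
    · simpa [af, bf] using H5 0
    · simpa [af, bf] using H5 2
    · intro h
      apply H4''
      have := h.2.2
      simpa [Tripath.fc, Tripath.dc, bf] using this
  obtain ⟨T, hT⟩ := T
  exact ⟨Θ, hfin, Θ, subset_rfl, T, hT⟩

end builder
end CQA

namespace CQA

section cliqueLemma

variable {n l : ℕ} {Elem Var : Type}

theorem solPair_difun {q : Query n Var} {a b c d : Fin n → Elem} (h1 : solPair q a b)
    (h2 : solPair q c b) (h3 : solPair q c d) : solPair q a d := by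
  classical
  obtain ⟨μ1, h1a, h1b⟩ := h1
  obtain ⟨μ2, h2a, h2b⟩ := h2
  obtain ⟨μ3, h3a, h3b⟩ := h3
  refine ⟨fun v => if v ∈ Set.range q.1 then μ1 v else μ3 v, fun i => ?_, fun i => ?_⟩
  · simp [h1a]
  · by_cases h : q.2 i ∈ Set.range q.1
    · simp only [h, if_true]
      obtain ⟨j, hj⟩ := h
      rw [h1b, ← h2b, ← hj, h2a, ← h3b, ← hj, h3a]
    · simp only [h, if_false, h3b]

theorem solPair_detL {q : Query n Var} (hq : TwoWayDet l q) {a b w : Fin n → Elem}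
    (h1 : solPair q a w) (h2 : solPair q b w) : keyEq l a b := by
  obtain ⟨μ1, h1a, h1b⟩ := h1
  obtain ⟨μ2, h2a, h2b⟩ := h2
  intro i hi
  obtain ⟨j, hj⟩ := hq.2.2.1 ⟨i, hi, rfl⟩
  rw [← h1a, ← h2a, ← hj, h1b, h2b]

theorem solPair_detR {q : Query n Var} (hq : TwoWayDet l q) {a b w : Fin n → Elem}
    (h1 : solPair q w a) (h2 : solPair q w b) : keyEq l a b := by
  obtain ⟨μ1, h1a, h1b⟩ := h1
  obtain ⟨μ2, h2a, h2b⟩ := h2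
  intro i hi
  obtain ⟨j, hj⟩ := hq.2.2.2 ⟨i, hi, rfl⟩
  rw [← h1b, ← h2b, ← hj, h1a, h2a]

theorem cliqueDB_of_star {q : Query n Var} (hq : TwoWayDet l q) (C : Set (Fin n → Elem))
    (star : ∀ d ∈ C, ∀ e ∈ C, ∀ f ∈ C, solPair q d e → solPair q e f → solPair q f d) :
    CliqueDB l q C := by
  have inv : ∀ a ∈ C, ∀ b, Relation.ReflTransGen (gEdge q C) a b → b ∈ C ∧
      (b = a ∨ solPair q a b ∨ solPair q b a ∨ (∃ w ∈ C, solPair q a w ∧ solPair q b w) ∨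
        (∃ w ∈ C, solPair q w a ∧ solPair q w b)) := by
    intro a ha b hab
    induction hab with
    | refl => exact ⟨ha, Or.inl rfl⟩
    | @tail b c _ hbc ih =>
      obtain ⟨hb, ih⟩ := ih
      obtain ⟨_, _, hc, hs⟩ := hbc
      have hs : solPair q b c ∨ solPair q c b := hs.imp (fun h => h.2.2) (fun h => h.2.2)
      refine ⟨hc, ?_⟩
      rcases ih with rfl | h | h | ⟨w, hw, h1, h2⟩ | ⟨w, hw, h1, h2⟩
      · rcases hs with h | h
        · exact Or.inr (Or.inl h)
        · exact Or.inr (Or.inr (Or.inl h))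
      · rcases hs with h' | h'
        · exact Or.inr (Or.inr (Or.inl (star _ ha _ hb _ hc h h')))
        · exact Or.inr (Or.inr (Or.inr (Or.inl ⟨b, hb, h, h'⟩)))
      · rcases hs with h' | h'
        · exact Or.inr (Or.inr (Or.inr (Or.inr ⟨b, hb, h, h'⟩)))
        · exact Or.inr (Or.inl (star _ hc _ hb _ ha h' h))
      · rcases hs with h' | h'
        · exact Or.inr (Or.inl (solPair_difun h1 h2 h'))
        · exact Or.inr (Or.inr (Or.inl (star _ ha _ hw _ hc h1 (star _ hc _ hb _ hw h' h2))))
      · rcases hs with h' | h'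
        · exact Or.inr (Or.inl (star _ hc _ hw _ ha (star _ hw _ hb _ hc h2 h') h1))
        · exact Or.inr (Or.inr (Or.inl (solPair_difun h' h2 h1)))
  intro a ha x hx y hy hxy
  have hsymm : Std.Symm (gEdge q C) :=
    ⟨fun u v h => ⟨h.1.symm, h.2.2.1, h.2.1, h.2.2.2.symm⟩⟩
  have h1 : Relation.ReflTransGen (gEdge q C) x a :=
    Relation.ReflTransGen.stdSymm.symm _ _ hx.2
  obtain ⟨_, h⟩ := inv x hx.1 y (h1.trans hy.2)
  rcases h with rfl | h | h | ⟨w, hw, h1, h2⟩ | ⟨w, hw, h1, h2⟩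
  · exact absurd (fun _ _ => rfl) hxy
  · exact Or.inl ⟨hx.1, hy.1, h⟩
  · exact Or.inr ⟨hy.1, hx.1, h⟩
  · exact absurd (solPair_detL hq h1 h2) hxy
  · exact absurd (solPair_detR hq h1 h2) hxy

end cliqueLemma
end CQA

namespace CQA

section partition

variable {n l : ℕ} {Elem Var : Type}

/-- a union of q-connected components -/
structure QClosed (l : ℕ) (q : Query n Var) (D C : Set (Fin n → Elem)) : Prop where
  sub : C ⊆ D
  key : ∀ a ∈ C, ∀ b ∈ D, keyEq l a b → b ∈ C
  sol : ∀ a ∈ C, ∀ b ∈ D, solPair q a b ∨ solPair q b a → b ∈ C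

theorem repair_iff (D r : Set (Fin n → Elem)) : Repair l D r ↔
    r ⊆ D ∧ Consistent l r ∧ ∀ x ∈ D, ∃ y ∈ r, keyEq l x y := by
  constructor
  · rintro ⟨h1, h2, h3⟩
    refine ⟨h1, h2, fun x hx => ?_⟩
    by_contra hcon
    push Not at hcon
    have : insert x r = r := h3 _ (Set.subset_insert _ _) (Set.insert_subset hx h1) (by
      rintro a (rfl | ha) b (rfl | hb) hab
      · rfl
      · exact absurd hab (hcon b hb)
      · exact absurd hab.symm (hcon a ha)
      · exact h2 a ha b hb hab)
    exact hcon x (this ▸ Set.mem_insert _ _) (keyEq_refl _)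
  · rintro ⟨h1, h2, h3⟩
    refine ⟨h1, h2, fun s hrs hsD hs => ?_⟩
    apply Set.Subset.antisymm _ hrs
    intro x hx
    obtain ⟨y, hy, hxy⟩ := h3 x (hsD hx)
    rwa [hs x hx y (hrs hy) hxy]

theorem certain_of_closed {q : Query n Var} {D C : Set (Fin n → Elem)} (hC : QClosed l q D C)
    (h : Certain l q C) : Certain l q D := by
  intro r hr
  rw [repair_iff] at hr
  obtain ⟨h1, h2, h3⟩ := hr
  have : Repair l C (r ∩ C) := by
    rw [repair_iff]
    refine ⟨Set.inter_subset_right, fun a ha b hb => h2 a ha.1 b hb.1, fun x hx => ?_⟩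
    obtain ⟨y, hy, hxy⟩ := h3 x (hC.sub hx)
    exact ⟨y, ⟨hy, hC.key x hx y (h1 hy) hxy⟩, hxy⟩
  obtain ⟨a, b, ha, hb, hab⟩ := h _ this
  exact ⟨a, b, ha.1, hb.1, hab⟩

theorem exists_certain {ι : Type} {q : Query n Var} {D : Set (Fin n → Elem)}
    (C : ι → Set (Fin n → Elem)) (hC : ∀ i, QClosed l q D (C i))
    (hdis : ∀ i j, i ≠ j → Disjoint (C i) (C j)) (hU : (⋃ i, C i) = D)
    (h : Certain l q D) : ∃ i, Certain l q (C i) := by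
  by_contra hcon
  simp only [Certain, not_exists, not_forall] at hcon
  choose r hr hns using hcon
  simp only [repair_iff] at hr
  have huniq : ∀ i j x, x ∈ C i → x ∈ C j → i = j := by
    intro i j x hi hj
    by_contra hij
    exact Set.disjoint_left.1 (hdis i j hij) hi hj
  have hrep : Repair l D (⋃ i, r i) := by
    rw [repair_iff]
    refine ⟨?_, ?_, ?_⟩
    · exact Set.iUnion_subset fun i => (hr i).1.trans (hC i).sub
    · intro a ha b hb hab
      obtain ⟨i, ha⟩ := Set.mem_iUnion.1 ha
      obtain ⟨j, hb⟩ := Set.mem_iUnion.1 hb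
      have hbj := (hr j).1 hb
      obtain rfl := huniq i j b ((hC i).key a ((hr i).1 ha) b ((hC j).sub hbj) hab) hbj
      exact (hr i).2.1 a ha b hb hab
    · intro x hx
      rw [← hU] at hx
      obtain ⟨i, hx⟩ := Set.mem_iUnion.1 hx
      obtain ⟨y, hy, hxy⟩ := (hr i).2.2 x hx
      exact ⟨y, Set.mem_iUnion.2 ⟨i, hy⟩, hxy⟩
  obtain ⟨a, b, ha, hb, hab⟩ := h _ hrep
  obtain ⟨i, ha⟩ := Set.mem_iUnion.1 ha
  obtain ⟨j, hb⟩ := Set.mem_iUnion.1 hb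
  have hbj := (hr j).1 hb
  obtain rfl := huniq i j b ((hC i).sol a ((hr i).1 ha) b ((hC j).sub hbj) (Or.inl hab)) hbj
  exact hns i ⟨a, b, ha, hb, hab⟩

theorem delta_of_closed {q : Query n Var} {D C : Set (Fin n → Elem)} (hC : QClosed l q D C) (k : ℕ)
    {S : Set (Fin n → Elem)} (h : S ∈ Delta l k q C) : S ∈ Delta l k q D := by
  intro 𝒮 h𝒮
  apply h 𝒮
  have hk : ∀ S, kSet l k C S → kSet l k D S := fun S h => ⟨h.1.trans hC.sub, h.2⟩
  refine ⟨fun S hS hs => h𝒮.1 S (hk S hS) hs, fun S hS hs => ?_⟩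
  apply h𝒮.2 S (hk S hS)
  obtain ⟨x, hx, hs⟩ := hs
  refine ⟨x, hC.sub hx, fun u hu hxu => ?_⟩
  obtain ⟨S', h1, h2, h3⟩ := hs u (hC.key x hx u hu hxu) hxu
  exact ⟨S', h1, hk _ h2, h3⟩

theorem block_closed {q : Query n Var} {D C : Set (Fin n → Elem)} (hC : QClosed l q D C)
    {x : Fin n → Elem} (hx : x ∈ C) : Block l C x = Block l D x := by
  ext y
  exact ⟨fun h => ⟨hC.sub h.1, h.2⟩, fun h => ⟨hC.key x hx y h.1 h.2, h.2⟩⟩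

theorem gComp_sub {q : Query n Var} {D C : Set (Fin n → Elem)} (hC : QClosed l q D C)
    {x : Fin n → Elem} (hx : x ∈ C) {y : Fin n → Elem}
    (h : Relation.ReflTransGen (gEdge q D) x y) :
    y ∈ C ∧ Relation.ReflTransGen (gEdge q C) x y := by
  induction h with
  | refl => exact ⟨hx, .refl⟩
  | @tail b c _ hbc ih =>
    obtain ⟨hb, ih⟩ := ih
    have hc : c ∈ C := hC.sol b hb c hbc.2.2.1
      (hbc.2.2.2.imp (fun h => h.2.2) (fun h => h.2.2))
    exact ⟨hc, ih.tail ⟨hbc.1, hb, hc,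
      hbc.2.2.2.imp (fun h => ⟨hb, hc, h.2.2⟩) (fun h => ⟨hc, hb, h.2.2⟩)⟩⟩

theorem solSym_mono {q : Query n Var} {D C : Set (Fin n → Elem)} (hC : C ⊆ D)
    {x y : Fin n → Elem} (h : SolSym q C x y) : SolSym q D x y :=
  h.imp (fun h => ⟨hC h.1, hC h.2.1, h.2.2⟩) (fun h => ⟨hC h.1, hC h.2.1, h.2.2⟩)

theorem gComp_closed {q : Query n Var} {D C : Set (Fin n → Elem)} (hC : QClosed l q D C)
    {x : Fin n → Elem} (hx : x ∈ C) : gComp q C x = gComp q D x := by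
  ext y
  refine ⟨fun h => ⟨hC.sub h.1, ?_⟩, fun h => gComp_sub hC hx h.2⟩
  have hle : ∀ a b, gEdge q C a b → gEdge q D a b :=
    fun a b h => ⟨h.1, hC.sub h.2.1, hC.sub h.2.2.1, solSym_mono hC.sub h.2.2.2⟩
  exact Relation.ReflTransGen.mono hle _ _ h.2

theorem cliqueOf_closed {q : Query n Var} {D C : Set (Fin n → Elem)} (hC : QClosed l q D C)
    {x : Fin n → Elem} (hx : x ∈ C) : cliqueOf l q C x = cliqueOf l q D x := by
  unfold cliqueOf
  rw [gComp_closed hC hx]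
  have : QuasiClique l q C (gComp q D x) ↔ QuasiClique l q D (gComp q D x) := by
    constructor
    · intro h a ha b hb hab
      exact solSym_mono hC.sub (h a ha b hb hab)
    · intro h a ha b hb hab
      have ha' := (gComp_sub hC hx ha.2).1
      have hb' := (gComp_sub hC hx hb.2).1
      exact (h a ha b hb hab).imp (fun h => ⟨ha', hb', h.2.2⟩) (fun h => ⟨hb', ha', h.2.2⟩)
  by_cases hQ : QuasiClique l q D (gComp q D x)
  · rw [if_pos hQ, if_pos (this.2 hQ)]
  · rw [if_neg hQ, if_neg (fun h => hQ (this.1 h))]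

theorem matching_closed {q : Query n Var} {D C : Set (Fin n → Elem)} (hC : QClosed l q D C)
    (h : SaturatingMatching l q D) : SaturatingMatching l q C := by
  obtain ⟨M, h1, h2⟩ := h
  refine ⟨M, fun x hx => ?_, fun x hx y hy => ?_⟩
  · rw [block_closed hC hx]
    obtain ⟨_, ⟨y, hy, hc⟩, a, ha, hac, hns⟩ := h1 x (hC.sub hx)
    have haC : a ∈ C := hC.key x hx a ha.1 ha.2
    have hyC : y ∈ C := by
      rw [hc] at hac
      unfold cliqueOf at hac
      split_ifs at hac
      · have hsymm : Std.Symm (gEdge q D) :=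
          ⟨fun u v h => ⟨h.1.symm, h.2.2.1, h.2.1, h.2.2.2.symm⟩⟩
        exact (gComp_sub hC haC (Relation.ReflTransGen.stdSymm.symm _ _ hac.2)).1
      · rw [Set.mem_singleton_iff] at hac
        rwa [← hac]
    refine ⟨⟨x, hx, (block_closed hC hx).symm⟩, ⟨y, hyC, ?_⟩, a, ha, hac, ?_⟩
    · rw [hc, cliqueOf_closed hC hyC]
    · exact fun h => hns ⟨hC.sub h.1, hC.sub h.2.1, h.2.2⟩
  · rw [block_closed hC hx, block_closed hC hy]
    exact h2 x (hC.sub hx) y (hC.sub hy)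

theorem qComponent_closed (q : Query n Var) (D : Set (Fin n → Elem)) (x : Fin n → Elem) :
    QClosed l q D (qComponent l q D x) := by
  refine ⟨fun y h => h.1, fun a ha b hb hab => ⟨hb, ?_⟩, fun a ha b hb hab => ⟨hb, ?_⟩⟩
  · exact ha.2.trans _ _ _ (.rel _ _ (Or.inl hab))
  · refine ha.2.trans _ _ _ (.rel _ _ (Or.inr ⟨a, b, ⟨ha.1, keyEq_refl _⟩, ⟨hb, keyEq_refl _⟩, ?_⟩))
    exact hab.imp (fun h => ⟨ha.1, hb, h⟩) (fun h => ⟨hb, ha.1, h⟩)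

/-- the key fact: a component with a tripath has no fork -/
def NoForkClaim (l : ℕ) (q : Query n Var) (D : Set (Fin n → Elem)) : Prop :=
  ∀ x, ContainsTripath l q (qComponent l q D x) →
    ∀ d ∈ qComponent l q D x, ∀ e ∈ qComponent l q D x, ∀ f ∈ qComponent l q D x,
      solPair q d e → solPair q e f → solPair q f d

theorem partition_main (q : Query n Var) (hq : TwoWayDet l q)
    (D : Set (Fin n → Elem)) (hD : D.Finite) (hclaim : NoForkClaim l q D) :
    ∃ N : ℕ, ∃ C : Fin N → Set (Fin n → Elem),
      (∀ i, (C i).Nonempty) ∧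
      (∀ i j, i ≠ j → Disjoint (C i) (C j)) ∧
      (⋃ i, C i) = D ∧
      (∀ i, ¬ ContainsTripath l q (C i) ∨ CliqueDB l q (C i)) ∧
      (Certain l q D ↔ ∃ i, Certain l q (C i)) ∧
      (∀ k, 1 ≤ k → (∃ i, ∅ ∈ Delta l k q (C i)) → ∅ ∈ Delta l k q D) ∧
      (SaturatingMatching l q D → ∀ i, SaturatingMatching l q (C i)) := by
  let 𝒞 : Set (Set (Fin n → Elem)) := (qComponent l q D) '' D
  have hfin : 𝒞.Finite := hD.image _
  have := hfin.to_subtype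
  obtain ⟨N, ⟨e⟩⟩ := Finite.exists_equiv_fin 𝒞
  let C : Fin N → Set (Fin n → Elem) := fun i => (e.symm i : Set (Fin n → Elem))
  have hform : ∀ i, ∃ x ∈ D, C i = qComponent l q D x := by
    intro i
    obtain ⟨x, hx, h⟩ := (e.symm i).2
    exact ⟨x, hx, h.symm⟩
  have hcl : ∀ i, QClosed l q D (C i) := by
    intro i
    obtain ⟨x, _, h⟩ := hform i
    rw [h]; exact qComponent_closed q D x
  have hdis : ∀ i j, i ≠ j → Disjoint (C i) (C j) := by
    intro i j hij
    rw [Set.disjoint_left]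
    intro z hz hz'
    apply hij
    apply e.symm.injective
    apply Subtype.ext
    change C i = C j
    obtain ⟨x, _, h⟩ := hform i
    obtain ⟨y, _, h'⟩ := hform j
    rw [h] at hz ⊢
    rw [h'] at hz' ⊢
    have hxy : qConn l q D x y := hz.2.trans _ _ _ (hz'.2.symm _ _)
    ext w
    exact ⟨fun hw => ⟨hw.1, (hxy.symm _ _).trans _ _ _ hw.2⟩, fun hw => ⟨hw.1, hxy.trans _ _ _ hw.2⟩⟩
  have hU : (⋃ i, C i) = D := by
    apply Set.Subset.antisymm
    · exact Set.iUnion_subset fun i => (hcl i).sub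
    · intro x hx
      refine Set.mem_iUnion.2 ⟨e ⟨qComponent l q D x, x, hx, rfl⟩, ?_⟩
      simp only [C, Equiv.symm_apply_apply]
      exact ⟨hx, .refl _⟩
  refine ⟨N, C, ?_, hdis, hU, ?_, ⟨exists_certain C hcl hdis hU, ?_⟩, ?_, ?_⟩
  · intro i
    obtain ⟨x, hx, h⟩ := hform i
    rw [h]; exact ⟨x, hx, .refl _⟩
  · intro i
    by_cases hT : ContainsTripath l q (C i)
    · right
      obtain ⟨x, hx, h⟩ := hform i
      rw [h] at hT ⊢
      exact cliqueDB_of_star hq _ (hclaim x hT)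
    · exact Or.inl hT
  · rintro ⟨i, h⟩; exact certain_of_closed (hcl i) h
  · rintro k _ ⟨i, h⟩; exact delta_of_closed (hcl i) k h
  · intro h i; exact matching_closed (hcl i) h

end partition
end CQA

namespace CQA

section tokens

variable {n l : ℕ} {Elem Var : Type}

/-- generating relation of the classes -/
inductive TRel (q : Query n Var) : Var × ZMod 3 → Var × ZMod 3 → Prop
  | step (p : Fin n) (s : ZMod 3) : TRel q (q.2 p, s) (q.1 p, s + 1)

/-- generating relation of the tokens -/
inductive KRel (l : ℕ) (q : Query n Var) : Var × ℤ → Var × ℤ → Prop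
  | step (p : Fin n) (hp : (p : ℕ) < l) (s : ℤ) : KRel l q (q.2 p, s) (q.1 p, s + 1)

/-- classes -/
def TT (q : Query n Var) : Type := Quot (TRel q)

/-- tokens -/
def Tok (l : ℕ) (q : Query n Var) : Type := Quot (KRel l q)

/-- the class of a variable at a height -/
def tc (q : Query n Var) (v : Var) (s : ZMod 3) : TT q := Quot.mk _ (v, s)

/-- the token of a variable at a height -/
def tk (l : ℕ) (q : Query n Var) (v : Var) (s : ℤ) : Tok l q := Quot.mk _ (v, s)

theorem tc_step (q : Query n Var) (p : Fin n) (s : ZMod 3) :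
    tc q (q.2 p) s = tc q (q.1 p) (s + 1) := Quot.sound (.step p s)

theorem tk_step (q : Query n Var) (p : Fin n) (hp : (p : ℕ) < l) (s : ℤ) :
    tk l q (q.2 p) s = tk l q (q.1 p) (s + 1) := Quot.sound (.step p hp s)

/-- the class of a token -/
def tcl (q : Query n Var) : Tok l q → TT q :=
  Quot.lift (fun x => tc q x.1 (x.2 : ZMod 3)) (by
    rintro _ _ ⟨p, hp, s⟩
    simp only [Int.cast_add, Int.cast_one]
    exact tc_step q p _)

theorem tcl_tk (q : Query n Var) (v : Var) (s : ℤ) : tcl q (tk l q v s) = tc q v (s : ZMod 3) := rfl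

/-- homomorphism out of the classes -/
theorem tc_hom (q : Query n Var) (ν : ZMod 3 → Var → Elem)
    (hν : ∀ s p, ν s (q.2 p) = ν (s + 1) (q.1 p)) {v v' : Var} {s s' : ZMod 3}
    (h : tc q v s = tc q v' s') : ν s v = ν s' v' := by
  have := congrArg (Quot.lift (fun x : Var × ZMod 3 => ν x.2 x.1) (by
    rintro _ _ ⟨p, s⟩; exact hν s p)) h
  exact this

theorem tc_rot (q : Query n Var) (m : ZMod 3) {v v' : Var} {s s' : ZMod 3}
    (h : tc q v s = tc q v' s') : tc q v (s + m) = tc q v' (s' + m) := by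
  have := congrArg (Quot.lift (fun x : Var × ZMod 3 => tc q x.1 (x.2 + m)) (by
    rintro _ _ ⟨p, s⟩
    change tc q _ (s + m) = tc q _ (s + 1 + m)
    rw [tc_step, add_right_comm])) h
  exact this

theorem tk_shift (q : Query n Var) (m : ℤ) {v v' : Var} {s s' : ℤ}
    (h : tk l q v s = tk l q v' s') : tk l q v (s + m) = tk l q v' (s' + m) := by
  have := congrArg (Quot.lift (fun x : Var × ℤ => tk l q x.1 (x.2 + m)) (by
    rintro _ _ ⟨p, hp, s⟩
    change tk l q _ (s + m) = tk l q _ (s + 1 + m)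
    rw [tk_step _ _ hp, add_right_comm])) h
  exact this

/-- key positions -/
def KP (n l : ℕ) : Finset (Fin n) := Finset.univ.filter (fun p => (p : ℕ) < l)

/-- circulations -/
def Circ (l : ℕ) (q : Query n Var) (z : Fin n → ℤ) : Prop :=
  ∀ φ : Var → ℤ, ∑ p ∈ KP n l, z p * (φ (q.1 p) - φ (q.2 p)) = 0

theorem path_lemma (q : Query n Var) (W : Var → ℤ)
    (hW : ∀ p : Fin n, W (q.2 p) = W (q.1 p)) {a b : Var × ℤ}
    (h : Relation.EqvGen (KRel l q) a b) :
    W a.1 = W b.1 ∧ ∃ z : Fin n → ℤ,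
      (∀ φ : Var → ℤ, ∑ p ∈ KP n l, z p * (φ (q.1 p) - φ (q.2 p)) = φ b.1 - φ a.1) ∧
      ∑ p ∈ KP n l, z p * W (q.1 p) = W a.1 * (b.2 - a.2) := by
  induction h with
  | rel a b h =>
    obtain ⟨p, hp, s⟩ := h
    have hmem : p ∈ KP n l := by simp [KP, hp]
    refine ⟨hW p, fun i => if i = p then 1 else 0, fun φ => ?_, ?_⟩
    · simp [hmem]
    · simp [hmem, hW]
  | refl a => exact ⟨rfl, fun _ => 0, fun φ => by simp, by simp⟩
  | symm a b _ ih =>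
    obtain ⟨h1, z, h2, h3⟩ := ih
    refine ⟨h1.symm, fun p => - z p, fun φ => ?_, ?_⟩
    · simp only [neg_mul, Finset.sum_neg_distrib, h2]; ring
    · simp only [neg_mul, Finset.sum_neg_distrib, h3, h1]; ring
  | trans a b c _ _ ih ih' =>
    obtain ⟨h1, z, h2, h3⟩ := ih
    obtain ⟨h1', z', h2', h3'⟩ := ih'
    refine ⟨h1.trans h1', fun p => z p + z' p, fun φ => ?_, ?_⟩
    · simp only [add_mul, Finset.sum_add_distrib, h2, h2']; ring
    · simp only [add_mul, Finset.sum_add_distrib, h3, h3', h1]; ring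

open Classical in
/-- weighted count of an element in the key -/
noncomputable def cnt (l : ℕ) (z : Fin n → ℤ) (x : Elem) (k : Fin n → Elem) : ℤ :=
  ∑ p ∈ KP n l, z p * (if k p = x then 1 else 0)

theorem cnt_keyEq (z : Fin n → ℤ) (x : Elem) {a b : Fin n → Elem} (h : keyEq l a b) :
    cnt l z x a = cnt l z x b := by
  unfold cnt
  refine Finset.sum_congr rfl fun p hp => ?_
  rw [h p (by simpa [KP] using hp)]

theorem cnt_sol (q : Query n Var) {z : Fin n → ℤ} (hz : Circ l q z) (x : Elem)
    {a b : Fin n → Elem} (h : solPair q a b) :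
    cnt l z x a = cnt l z x b := by
  classical
  obtain ⟨μ, h1, h2⟩ := h
  have := hz (fun v => if μ v = x then 1 else 0)
  simp only [mul_sub, Finset.sum_sub_distrib, h1, h2] at this
  unfold cnt
  convert sub_eq_zero.1 this

theorem cnt_qConn (q : Query n Var) {z : Fin n → ℤ} (hz : Circ l q z) (x : Elem)
    (D : Set (Fin n → Elem)) {a b : Fin n → Elem} (h : qConn l q D a b) :
    cnt l z x a = cnt l z x b := by
  induction h with
  | rel a b h =>
    rcases h with h | ⟨a', b', ha, hb, h⟩
    · exact cnt_keyEq z x h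
    · rw [cnt_keyEq z x ha.2, cnt_keyEq z x hb.2]
      rcases h with h | h
      · exact cnt_sol q hz x h.2.2
      · exact (cnt_sol q hz x h.2.2).symm
  | refl a => rfl
  | symm a b _ ih => exact ih.symm
  | trans a b c _ _ ih ih' => exact ih.trans ih'

theorem height_unique (q : Query n Var) (ν : ZMod 3 → Var → Elem)
    (hν : ∀ s p, ν s (q.2 p) = ν (s + 1) (q.1 p)) (x : Elem)
    (hcnt : ∀ z, Circ l q z → ∀ δ, cnt l z x (fun p => ν δ (q.1 p)) = 0)
    {v : Var} {S S' : ℤ} (hv : ν (S : ZMod 3) v = x) (h : tk l q v S = tk l q v S') : S = S' := by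
  classical
  let W : Var → ℤ := fun v => ∑ δ : ZMod 3, if ν δ v = x then 1 else 0
  have hW : ∀ p, W (q.2 p) = W (q.1 p) := by
    intro p
    simp only [W, hν]
    exact Equiv.sum_comp (Equiv.addRight (1 : ZMod 3)) (fun δ => if ν δ (q.1 p) = x then (1:ℤ) else 0)
  obtain ⟨_, z, h2, h3⟩ := path_lemma q W hW (Quot.eqvGen_exact h)
  simp only at h2 h3
  have hz : Circ l q z := fun φ => by rw [h2]; ring
  have h0 : ∑ p ∈ KP n l, z p * W (q.1 p) = 0 := by
    simp only [W, Finset.mul_sum]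
    rw [Finset.sum_comm]
    refine Finset.sum_eq_zero fun δ _ => ?_
    refine Eq.trans ?_ (hcnt z hz δ)
    unfold cnt
    refine Finset.sum_congr rfl fun p _ => ?_
    congr
  have hpos : 0 < W v := by
    refine Finset.sum_pos' (fun δ _ => by split_ifs <;> simp) ⟨(S : ZMod 3), Finset.mem_univ _, ?_⟩
    simp [hv]
  rw [h0] at h3
  rcases mul_eq_zero.1 h3.symm with h | h
  · omega
  · omega

/-- occurrence heights of a token -/
def occ (l : ℕ) (q : Query n Var) (τ : Tok l q) : Set ℤ :=
  {s | ∃ p : Fin n, (p : ℕ) < l ∧ tk l q (q.1 p) s = τ}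

theorem occ_inj (q : Query n Var) (ν : ZMod 3 → Var → Elem)
    (hν : ∀ s p, ν s (q.2 p) = ν (s + 1) (q.1 p)) (x : Elem)
    (hcnt : ∀ z, Circ l q z → ∀ δ, cnt l z x (fun p => ν δ (q.1 p)) = 0)
    (v0 : Var) (s0 : ZMod 3) (hv0 : ν s0 v0 = x)
    (τ : Tok l q) (hτ : tcl q τ = tc q v0 s0) :
    ∃ f : occ l q τ → Fin n, Function.Injective f := by
  have : ∀ s : occ l q τ, ∃ p : Fin n, (p : ℕ) < l ∧ tk l q (q.1 p) s = τ := fun s => s.2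
  choose f hf1 hf2 using this
  refine ⟨f, fun s s' hss => ?_⟩
  apply Subtype.ext
  refine height_unique (v := q.1 (f s)) q ν hν x hcnt ?_ ?_
  · rw [← hv0]
    apply tc_hom q ν hν
    rw [← hτ]
    exact congrArg (tcl q) (hf2 s)
  · rw [hf2]
    conv_rhs => rw [hss]
    rw [hf2]

theorem fresh (q : Query n Var) (p0 : Fin n) (hp0 : (p0 : ℕ) < l) (s0 : ℤ)
    (hfin : (occ l q (tk l q (q.1 p0) s0)).Finite) (h : ℤ) :
    (∃ p : Fin n, (p : ℕ) < l ∧ h - 1 ∉ occ l q (tk l q (q.1 p) h)) ∧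
    (∃ p : Fin n, (p : ℕ) < l ∧ h + 1 ∉ occ l q (tk l q (q.1 p) h)) := by
  have hne : (occ l q (tk l q (q.1 p0) s0)).Nonempty := ⟨s0, p0, hp0, rfl⟩
  constructor
  · obtain ⟨s, ⟨p, hp, hs⟩, hmin⟩ := Set.exists_min_image _ id hfin hne
    refine ⟨p, hp, ?_⟩
    rintro ⟨p', hp', h'⟩
    have := tk_shift q (s - h) h'
    have e1 : h - 1 + (s - h) = s - 1 := by ring
    have e2 : h + (s - h) = s := by ring
    rw [e1, e2, hs] at this
    have := hmin (s - 1) ⟨p', hp', this⟩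
    simp at this
  · obtain ⟨s, ⟨p, hp, hs⟩, hmin⟩ := Set.exists_max_image _ id hfin hne
    refine ⟨p, hp, ?_⟩
    rintro ⟨p', hp', h'⟩
    have := tk_shift q (s - h) h'
    have e1 : h + 1 + (s - h) = s + 1 := by ring
    have e2 : h + (s - h) = s := by ring
    rw [e1, e2, hs] at this
    have := hmin (s + 1) ⟨p', hp', this⟩
    simp at this

end tokens
end CQA

namespace CQA

section walks

variable {n l : ℕ} {Elem Var : Type}

/-- two keys are linked by a solution -/
def KR (l : ℕ) (q : Query n Var) (x y : Fin n → Elem) : Prop :=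
  ∃ ν : Var → Elem, keyEq l x (fun p => ν (q.1 p)) ∧ keyEq l y (fun p => ν (q.2 p))

/-- a step of a walk -/
def WStep (l : ℕ) (q : Query n Var) (u w : ℤ × (Fin n → Elem)) : Prop :=
  (w.1 = u.1 + 1 ∧ KR l q u.2 w.2) ∨ (w.1 = u.1 - 1 ∧ KR l q w.2 u.2)

/-- walks that eventually go up -/
def HasWalk (l : ℕ) (q : Query n Var) (y0 : Fin n → Elem) : Prop :=
  ∀ s0 : ℤ, ∃ w : ℕ → ℤ × (Fin n → Elem), (w 0).1 = s0 ∧ keyEq l (w 0).2 y0 ∧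
    (∀ t, WStep l q (w t) (w (t+1))) ∧ ∃ M, ∀ t, M ≤ t → (w (t+1)).1 = (w t).1 + 1

theorem KR.congr {q : Query n Var} {x x' y y' : Fin n → Elem} (h : KR l q x y)
    (hx : keyEq l x' x) (hy : keyEq l y' y) : KR l q x' y' := by
  obtain ⟨ν, h1, h2⟩ := h
  exact ⟨ν, hx.trans h1, hy.trans h2⟩

theorem KR_of_sol {q : Query n Var} {x y : Fin n → Elem} (h : solPair q x y) : KR l q x y := by
  obtain ⟨μ, h1, h2⟩ := h
  exact ⟨μ, fun p _ => (h1 p).symm, fun p _ => (h2 p).symm⟩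

theorem HasWalk.prepend {q : Query n Var} {y0 y1 : Fin n → Elem} (h : HasWalk l q y1)
    (hs : KR l q y0 y1 ∨ KR l q y1 y0) : HasWalk l q y0 := by
  intro s0
  have key : ∀ s1, (∀ z, keyEq l z y1 → WStep l q (s0, y0) (s1, z)) →
      ∃ w : ℕ → ℤ × (Fin n → Elem), (w 0).1 = s0 ∧ keyEq l (w 0).2 y0 ∧
      (∀ t, WStep l q (w t) (w (t+1))) ∧ ∃ M, ∀ t, M ≤ t → (w (t+1)).1 = (w t).1 + 1 := by
    intro s1 hs1
    obtain ⟨w, h1, h2, h3, M, h4⟩ := h s1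
    refine ⟨fun t => Nat.casesOn t (s0, y0) w, rfl, keyEq_refl _, ?_, M + 1, ?_⟩
    · rintro (_ | t)
      · have := hs1 _ h2
        rw [← h1] at this
        exact this
      · exact h3 t
    · rintro (_ | t) ht
      · omega
      · exact h4 t (by omega)
  rcases hs with hs | hs
  · exact key (s0 + 1) fun z hz => Or.inl ⟨rfl, hs.congr (keyEq_refl _) hz⟩
  · exact key (s0 - 1) fun z hz => Or.inr ⟨rfl, hs.congr hz (keyEq_refl _)⟩

theorem HasWalk.keyEq {q : Query n Var} {y0 y1 : Fin n → Elem} (h : HasWalk l q y1)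
    (hk : CQA.keyEq l y1 y0) : HasWalk l q y0 := by
  intro s0
  obtain ⟨w, h1, h2, h3⟩ := h s0
  exact ⟨w, h1, h2.trans hk, h3⟩

theorem hasWalk_qConn (q : Query n Var) (D : Set (Fin n → Elem)) {a b : Fin n → Elem}
    (h : qConn l q D a b) : HasWalk l q a ↔ HasWalk l q b := by
  induction h with
  | rel a b h =>
    rcases h with h | ⟨a', b', ha, hb, h⟩
    · exact ⟨fun w => w.keyEq h, fun w => w.keyEq h.symm⟩
    · have hK : KR l q a b ∨ KR l q b a := h.imp
        (fun h => (KR_of_sol h.2.2).congr ha.2 hb.2) (fun h => (KR_of_sol h.2.2).congr hb.2 ha.2)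
      exact ⟨fun w => w.prepend hK.symm, fun w => w.prepend hK⟩
  | refl a => rfl
  | symm a b _ ih => exact ih.symm
  | trans a b c _ _ ih ih' => exact ih.trans ih'

theorem hasWalk_tri (q : Query n Var) (ν : ZMod 3 → Var → Elem)
    (hν : ∀ s p, ν s (q.2 p) = ν (s + 1) (q.1 p)) (δ : ZMod 3) :
    HasWalk l q (fun p => ν δ (q.1 p)) := by
  intro s0
  refine ⟨fun t => (s0 + t, fun p => ν (δ + t) (q.1 p)), by simp, fun p _ => by simp, ?_, 0, ?_⟩
  · intro t
    left
    refine ⟨by push_cast; ring, ν (δ + t), keyEq_refl _, fun p _ => ?_⟩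
    simp only [hν]
    push_cast
    rw [add_assoc]
  · intro t _
    push_cast; ring

end walks

section branch

variable {n l : ℕ} {Elem Var : Type}

open Classical in
/-- entry time of a token -/
noncomputable def ent (l : ℕ) (q : Query n Var) (s : ℕ → ℤ) (τ : Tok l q) : ℕ → Option ℕ
  | 0 => if s 0 ∈ occ l q τ then none else some 0
  | t + 1 => if s (t + 1) ∈ occ l q τ then ent l q s τ t else some (t + 1)

theorem ent_le (q : Query n Var) (s : ℕ → ℤ) (τ : Tok l q) (t j : ℕ)
    (h : ent l q s τ t = some j) : j ≤ t := by
  induction t with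
  | zero =>
    unfold ent at h
    split_ifs at h
    simp at h; omega
  | succ t ih =>
    unfold ent at h
    split_ifs at h
    · have := ih h; omega
    · simp at h; omega

theorem ent_none (q : Query n Var) (s : ℕ → ℤ) (τ : Tok l q) (t : ℕ)
    (h : ent l q s τ t = none) : ∀ t' ≤ t, s t' ∈ occ l q τ := by
  induction t with
  | zero =>
    unfold ent at h
    split_ifs at h with h1
    intro t' ht
    obtain rfl : t' = 0 := by omega
    exact h1
  | succ t ih =>
    unfold ent at h
    split_ifs at h with h1
    intro t' ht
    rcases Nat.lt_or_ge t' (t+1) with h2 | h2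
    · exact ih h t' (by omega)
    · obtain rfl : t' = t + 1 := by omega
      exact h1

theorem ent_not_mem (q : Query n Var) (s : ℕ → ℤ) (τ : Tok l q) (t : ℕ)
    (h : s t ∉ occ l q τ) : ent l q s τ t = some t := by
  cases t with
  | zero => unfold ent; rw [if_neg h]
  | succ t => unfold ent; rw [if_neg h]

/-- label of a token -/
noncomputable def lab (l : ℕ) (q : Query n Var) (i : Fin 3) (s : ℕ → ℤ) (τ : Tok l q) (t : ℕ) :
    TT q ⊕ (Fin 3 × ℕ) :=
  match ent l q s τ t with
  | none => Sum.inl (tcl q τ)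
  | some j => Sum.inr (i, j)

theorem lab_inr (q : Query n Var) (i : Fin 3) (s : ℕ → ℤ) (τ : Tok l q) (t : ℕ) (i' : Fin 3) (j : ℕ)
    (h : lab l q i s τ t = Sum.inr (i', j)) : i' = i ∧ j ≤ t := by
  unfold lab at h
  split at h
  · simp at h
  · rename_i k hk
    have := ent_le q s τ t k hk
    simp only [Sum.inr.injEq, Prod.mk.injEq] at h
    exact ⟨h.1.symm, by omega⟩

theorem lab_inl (q : Query n Var) (i : Fin 3) (s : ℕ → ℤ) (τ : Tok l q) (t : ℕ) (x : TT q)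
    (h : lab l q i s τ t = Sum.inl x) : tcl q τ = x ∧ ent l q s τ t = none := by
  unfold lab at h
  split at h
  · rename_i hk
    simp only [Sum.inl.injEq] at h
    exact ⟨h, hk⟩
  · simp at h

theorem lab_succ (q : Query n Var) (i : Fin 3) (s : ℕ → ℤ) (τ : Tok l q) (t : ℕ)
    (h : s (t + 1) ∈ occ l q τ) : lab l q i s τ (t + 1) = lab l q i s τ t := by
  have : ent l q s τ (t + 1) = ent l q s τ t := by
    conv_lhs => unfold ent
    rw [if_pos h]
  unfold lab
  rw [this]

theorem lab_zero (q : Query n Var) (i : Fin 3) (s : ℕ → ℤ) (τ : Tok l q)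
    (h : s 0 ∈ occ l q τ) : lab l q i s τ 0 = Sum.inl (tcl q τ) := by
  have : ent l q s τ 0 = none := by
    unfold ent
    rw [if_pos h]
  unfold lab
  rw [this]

theorem lab_not_mem (q : Query n Var) (i : Fin 3) (s : ℕ → ℤ) (τ : Tok l q) (t : ℕ)
    (h : s t ∉ occ l q τ) : lab l q i s τ t = Sum.inr (i, t) := by
  unfold lab
  rw [ent_not_mem q s τ t h]

/-- labelled elements -/
abbrev LE (Elem : Type) (q : Query n Var) : Type := (TT q ⊕ (Fin 3 × ℕ)) × Elem

theorem branch_lemma (q : Query n Var) (hq : TwoWayDet l q) (i : Fin 3)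
    (w : ℕ → ℤ × (Fin n → Elem)) (hw : ∀ t, WStep l q (w t) (w (t+1)))
    (M : ℕ) (hM : ∀ t, M ≤ t → (w (t+1)).1 = (w t).1 + 1)
    (hfresh : ∀ h : ℤ, (∃ p : Fin n, (p : ℕ) < l ∧ h - 1 ∉ occ l q (tk l q (q.1 p) h)) ∧
      (∃ p : Fin n, (p : ℕ) < l ∧ h + 1 ∉ occ l q (tk l q (q.1 p) h)))
    (x : TT q)
    (hocc : ∀ τ : Tok l q, tcl q τ = x → ∃ f : occ l q τ → Fin n, Function.Injective f)
    (c : Fin n → LE Elem q) (hc1 : ∀ p, (c p).1 = Sum.inl (tc q (q.1 p) ((w 0).1 : ZMod 3)))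
    (hc2 : ∀ p : Fin n, (p : ℕ) < l → (c p).2 = (w 0).2 p) :
    ∃ fi fo : ℕ → Fin n → LE Elem q, fi 0 = c ∧
      (∀ t, keyEq l (fi t) (fo t)) ∧ (∀ t, fo t ≠ fi t) ∧
      (∀ t, solPair q (fo t) (fi (t+1)) ∨ solPair q (fi (t+1)) (fo t)) ∧
      (∀ t, ∃ p : Fin n, (p : ℕ) < l ∧ (fi (t+1) p).1 = Sum.inr (i, t)) ∧
      (∀ t, ∀ p : Fin n, (p : ℕ) < l → ∀ i' j, (fi t p).1 = Sum.inr (i', j) → i' = i ∧ j < t) ∧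
      (∀ t, M + n ≤ t → ∀ p : Fin n, (p : ℕ) < l → (fi t p).1 ≠ Sum.inl x) := by
  let s : ℕ → ℤ := fun t => (w t).1
  let y : ℕ → Fin n → Elem := fun t => (w t).2
  have hstep : ∀ t, ∃ (P Q : Fin n → Var) (h : ℤ) (m : Var → Elem),
      ((P = q.1 ∧ Q = q.2) ∨ (P = q.2 ∧ Q = q.1)) ∧
      (∀ p : Fin n, (p : ℕ) < l → tk l q (P p) h = tk l q (q.1 p) (s t)) ∧
      (∀ p : Fin n, (p : ℕ) < l → tk l q (Q p) h = tk l q (q.1 p) (s (t+1))) ∧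
      (∀ p : Fin n, (p : ℕ) < l → m (P p) = y t p) ∧
      (∀ p : Fin n, (p : ℕ) < l → m (Q p) = y (t+1) p) ∧
      keySet l Q ⊆ varsSet P ∧
      (∃ p : Fin n, (p : ℕ) < l ∧ s t ∉ occ l q (tk l q (q.1 p) (s (t+1)))) := by
    intro t
    rcases hw t with ⟨h1, m, h2, h3⟩ | ⟨h1, m, h2, h3⟩
    · refine ⟨q.1, q.2, s t, m, Or.inl ⟨rfl, rfl⟩, fun _ _ => rfl, fun p hp => ?_,
        fun p hp => (h2 p hp).symm, fun p hp => (h3 p hp).symm, hq.2.2.2, ?_⟩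
      · rw [tk_step q p hp]; simp only [s, h1]
      · obtain ⟨p, hp, h⟩ := (hfresh (s (t+1))).1
        refine ⟨p, hp, ?_⟩
        have : s t = s (t+1) - 1 := by simp only [s, h1]; ring
        rwa [this]
    · refine ⟨q.2, q.1, s (t+1), m, Or.inr ⟨rfl, rfl⟩, fun p hp => ?_, fun p hp => rfl,
        fun p hp => (h3 p hp).symm, fun p hp => (h2 p hp).symm, hq.2.2.1, ?_⟩
      · rw [tk_step q p hp]
        congr 1
        simp only [s, h1]; ring
      · obtain ⟨p, hp, h⟩ := (hfresh (s (t+1))).2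
        refine ⟨p, hp, ?_⟩
        have : s t = s (t+1) + 1 := by simp only [s, h1]; ring
        rwa [this]
  choose P Q h m hPQ hP hQ hmP hmQ hsub hfr using hstep
  let μ : ℕ → Var → LE Elem q := fun t v => (lab l q i s (tk l q v (h t)) t, m t v)
  let fo : ℕ → Fin n → LE Elem q := fun t p => μ t (P t p)
  let fi : ℕ → Fin n → LE Elem q := fun t => Nat.casesOn t c (fun t p => μ t (Q t p))
  have hfi0 : fi 0 = c := rfl
  have hfiS : ∀ t p, fi (t+1) p = μ t (Q t p) := fun t p => rfl
  have hmem : ∀ t (p : Fin n), (p : ℕ) < l → s t ∈ occ l q (tk l q (q.1 p) (s t)) :=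
    fun t p hp => ⟨p, hp, rfl⟩
  have hfo : ∀ t (p : Fin n), (p : ℕ) < l → fo t p = (lab l q i s (tk l q (q.1 p) (s t)) t, y t p) := by
    intro t p hp
    simp only [fo, μ]
    rw [hP t p hp, hmP t p hp]
  have hfi : ∀ t (p : Fin n), (p : ℕ) < l → fi t p = (lab l q i s (tk l q (q.1 p) (s t)) t, y t p) := by
    rintro (_ | t) p hp
    · rw [hfi0, lab_zero q i s _ (hmem 0 p hp)]
      exact Prod.ext (hc1 p) (hc2 p hp)
    · rw [hfiS, lab_succ q i s _ t (hmem (t+1) p hp)]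
      simp only [μ]
      rw [hQ t p hp, hmQ t p hp]
  have hnew : ∀ t, ∃ p : Fin n, (p : ℕ) < l ∧ (fi (t+1) p).1 = Sum.inr (i, t) := by
    intro t
    obtain ⟨p, hp, hn⟩ := hfr t
    refine ⟨p, hp, ?_⟩
    rw [hfi (t+1) p hp, lab_succ q i s _ t (hmem (t+1) p hp)]
    exact lab_not_mem q i s _ t hn
  have hall : ∀ t p i' j, (fi t p).1 = Sum.inr (i', j) → i' = i ∧ j < t := by
    rintro (_ | t) p i' j hj
    · rw [hfi0, hc1] at hj
      simp at hj
    · rw [hfiS] at hj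
      obtain ⟨h1, h2⟩ := lab_inr q i s _ t i' j hj
      exact ⟨h1, by omega⟩
  refine ⟨fi, fo, hfi0, ?_, ?_, ?_, hnew, fun t p _ => hall t p, ?_⟩
  · intro t p hp
    rw [hfi t p hp, hfo t p hp]
  · intro t heq
    obtain ⟨p, hp, hlab⟩ := hnew t
    obtain ⟨p', hp'⟩ := hsub t ⟨p, hp, rfl⟩
    have : (fo t p').1 = Sum.inr (i, t) := by
      rw [← hlab, hfiS]
      simp only [fo, hp']
    rw [heq] at this
    have := (hall t p' _ _ this).2
    omega
  · intro t
    rcases hPQ t with ⟨h1, h2⟩ | ⟨h1, h2⟩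
    · left
      refine ⟨μ t, fun p => ?_, fun p => ?_⟩
      · simp only [fo, h1]
      · rw [hfiS, h2]
    · right
      refine ⟨μ t, fun p => ?_, fun p => ?_⟩
      · rw [hfiS, h2]
      · simp only [fo, h1]
  · intro t ht p hp heq
    rw [hfi t p hp] at heq
    obtain ⟨h1, h2⟩ := lab_inl q i s _ t x heq
    obtain ⟨f, hf⟩ := hocc _ h1
    have hmem' := ent_none q s _ t h2
    have hs : ∀ k : ℕ, s (M + k) = s M + k := by
      intro k
      induction k with
      | zero => simp
      | succ k ih =>
        have := hM (M + k) (by omega)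
        change s (M + k + 1) = s (M + k) + 1 at this
        rw [← add_assoc, this, ih]; push_cast; ring
    let g : Fin (n+1) → Fin n := fun k => f ⟨s (M + k), hmem' _ (by omega)⟩
    have hg : Function.Injective g := by
      intro a b hab
      have h3 := congrArg Subtype.val (hf hab)
      simp only [hs] at h3
      ext
      omega
    have := Fintype.card_le_of_injective g hg
    simp at this

end branch
end CQA

namespace CQA

section assembly

variable {n l : ℕ} {Elem Var : Type}

theorem gSet_cases (l : ℕ) (d e f : Fin n → Elem) :
    (gSet l d e f = keySet l d ∧ keySet l d ⊆ keySet l e) ∨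
    (gSet l d e f = keySet l f ∧ keySet l f ⊆ keySet l e) ∨ gSet l d e f = keySet l e := by
  unfold gSet
  split_ifs with h1 h2 h3 h4
  · exact Or.inl ⟨rfl, h1.1⟩
  · exact Or.inr (Or.inl ⟨rfl, h2.2⟩)
  · exact Or.inl ⟨rfl, h3.1.trans h3.2⟩
  · exact Or.inr (Or.inl ⟨rfl, h4.1.trans h4.2⟩)
  · exact Or.inr (Or.inr rfl)

theorem keySet_rot (q : Query n Var) (m a b : ZMod 3)
    (h : keySet l (fun p => tc q (q.1 p) a) ⊆ keySet l (fun p => tc q (q.1 p) b)) :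
    keySet l (fun p => tc q (q.1 p) (a + m)) ⊆ keySet l (fun p => tc q (q.1 p) (b + m)) := by
  rintro _ ⟨p, hp, rfl⟩
  obtain ⟨p', hp', h'⟩ := h ⟨p, hp, rfl⟩
  exact ⟨p', hp', tc_rot q m h'⟩

theorem fork_of_data [Countable Elem] [Infinite Elem] [Countable Var]
    (q : Query n Var) (hq : TwoWayDet l q) (ν : ZMod 3 → Var → Elem)
    (hν : ∀ s p, ν s (q.2 p) = ν (s + 1) (q.1 p))
    (hdist : ∀ i i' : ZMod 3,
      keyEq l (fun p => ν i (q.1 p)) (fun p => ν i' (q.1 p)) → i = i')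
    (p0 : Fin n) (hp0 : (p0 : ℕ) < l)
    (hcnt : ∀ z, Circ l q z → ∀ δ, cnt l z (ν 1 (q.1 p0)) (fun p => ν δ (q.1 p)) = 0)
    (c : Fin 3 → Fin n → Elem) (hwalk : ∀ i, HasWalk l q (c i))
    (h01 : solPair q (c 0) (c 1)) (h12 : solPair q (c 1) (c 2))
    (h20 : ¬ solPair q (c 2) (c 0)) : AdmitsForkTripath l q Elem := by
  classical
  let x : TT q := tc q (q.1 p0) 1
  have hocc : ∀ τ : Tok l q, tcl q τ = x → ∃ f : occ l q τ → Fin n, Function.Injective f :=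
    fun τ hτ => occ_inj q ν hν (ν 1 (q.1 p0)) hcnt (q.1 p0) 1 rfl τ hτ
  have hfresh := fresh q p0 hp0 1 (by
    obtain ⟨f, hf⟩ := hocc (tk l q (q.1 p0) 1) (by rw [tcl_tk]; simp [x])
    have := Finite.of_injective f hf
    exact Set.toFinite _)
  choose w hw0 hwk hws M hM using fun i : Fin 3 => hwalk i ((i : ℕ) : ℤ)
  let cc : Fin 3 → Fin n → LE Elem q := fun i p =>
    (Sum.inl (tc q (q.1 p) (((w i 0).1 : ℤ) : ZMod 3)), c i p)
  choose fi fo hfi0 H1 H1' H3 hnew hall hx using fun i : Fin 3 =>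
    branch_lemma q hq i (w i) (hws i) (M i) (hM i) hfresh x hocc (cc i) (fun p => rfl)
      (fun p hp => (hwk i p hp).symm)
  -- embedding into the elements
  have hcT : Countable (TT q) := by
    unfold TT; infer_instance
  have hemb : ∃ ι : LE Elem q → Elem, Function.Injective ι := by
    obtain ⟨g, hg⟩ := exists_injective_nat (LE Elem q)
    let k : ℕ ↪ Elem := Infinite.natEmbedding Elem
    exact ⟨fun z => k (g z), fun a b h => hg (k.injective h)⟩
  obtain ⟨ι, hι⟩ := hemb
  have hne : Nonempty (LE Elem q) := ⟨(Sum.inl x, Classical.arbitrary Elem)⟩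
  obtain ⟨g, hg⟩ := hι.hasLeftInverse
  have hkey : ∀ a b : Fin n → LE Elem q,
      keyEq l (fun p => ι (a p)) (fun p => ι (b p)) ↔ keyEq l a b := by
    intro a b
    exact ⟨fun h p hp => hι (h p hp), fun h p hp => congrArg ι (h p hp)⟩
  have hsol : ∀ a b : Fin n → LE Elem q, solPair q a b →
      solPair q (fun p => ι (a p)) (fun p => ι (b p)) := by
    rintro a b ⟨μ, h1, h2⟩
    exact ⟨fun v => ι (μ v), fun p => congrArg ι (h1 p), fun p => congrArg ι (h2 p)⟩
  have hw0' : ∀ i, (((w i 0).1 : ℤ) : ZMod 3) = ((i : ℕ) : ZMod 3) := by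
    intro i; rw [hw0]; simp
  have hcc : ∀ i p, cc i p = (Sum.inl (tc q (q.1 p) ((i : ℕ) : ZMod 3)), c i p) := by
    intro i p; simp only [cc, hw0']
  have hccsol : ∀ i j : Fin 3, ((j : ℕ) : ZMod 3) = ((i : ℕ) : ZMod 3) + 1 →
      solPair q (c i) (c j) → solPair q (cc i) (cc j) := by
    rintro i j hij ⟨μ, h1, h2⟩
    refine ⟨fun v => (Sum.inl (tc q v ((i : ℕ) : ZMod 3)), μ v), fun p => ?_, fun p => ?_⟩
    · simp only [hcc, h1]
    · simp only [hcc, h2, tc_step, hij]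
  have hNle : ∀ i : Fin 3, M i + n ≤ M 0 + M 1 + M 2 + n := by
    intro i; fin_cases i <;> simp <;> omega
  refine tripath_builder q (M 0 + M 1 + M 2 + n) (fun i t p => ι (fi i t p))
    (fun i t p => ι (fo i t p)) ?_ ?_ ?_ ?_ ?_ ?_ ?_ ?_
  · intro i t _
    exact (hkey _ _).2 (H1 i t)
  · intro i t _ h
    apply H1' i t
    funext p
    exact hι (congrFun h p)
  · intro i i' t t' _ _ h
    rw [hkey] at h
    rcases t with _ | t
    · rcases t' with _ | t'
      · refine ⟨?_, rfl⟩
        rw [hfi0, hfi0] at h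
        have : ((i : ℕ) : ZMod 3) = ((i' : ℕ) : ZMod 3) := by
          apply hdist
          intro p hp
          have h1 := h p hp
          rw [hcc, hcc, Prod.mk.injEq, Sum.inl.injEq] at h1
          exact tc_hom q ν hν h1.1
        revert this
        revert i i'
        clear * -
        intro i i' _ h
        fin_cases i <;> fin_cases i' <;> first | rfl | (exact absurd h (by decide))
      · exfalso
        obtain ⟨p, hp, h1⟩ := hnew i' t'
        rw [← h p hp] at h1
        have := (hall i 0 p hp _ _ h1).2
        omega
    · obtain ⟨p, hp, h1⟩ := hnew i t
      rw [h p hp] at h1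
      obtain ⟨rfl, h2⟩ := hall i' t' p hp _ _ h1
      refine ⟨rfl, ?_⟩
      rcases t' with _ | t'
      · omega
      · obtain ⟨p, hp, h1⟩ := hnew i t'
        rw [← h p hp] at h1
        have := (hall i _ p hp _ _ h1).2
        omega
  · intro i t _
    exact (H3 i t).imp (hsol _ _) (hsol _ _)
  · apply hsol
    rw [hfi0, hfi0]
    exact hccsol 0 1 (by simp) h01
  · apply hsol
    rw [hfi0, hfi0]
    exact hccsol 1 2 (by decide) h12
  · rintro ⟨μ, h1, h2⟩
    apply h20
    refine ⟨fun v => (g (μ v)).2, fun p => ?_, fun p => ?_⟩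
    · simp only [h1, hfi0, cc]
      rw [hg]
    · simp only [h2, hfi0, cc]
      rw [hg]
  · intro i hsub
    rw [hfi0, hfi0, hfi0] at hsub
    let t : ZMod 3 → Fin n → TT q := fun a p => tc q (q.1 p) a
    -- inclusions project to the classes
    have hproj : ∀ i j : Fin 3, keySet l (fun p => ι (cc i p)) ⊆ keySet l (fun p => ι (cc j p)) →
        keySet l (t ((i : ℕ) : ZMod 3)) ⊆ keySet l (t ((j : ℕ) : ZMod 3)) := by
      rintro i j h _ ⟨p, hp, rfl⟩
      obtain ⟨p', hp', h'⟩ := h ⟨p, hp, rfl⟩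
      have h1 := hι h'
      rw [hcc, hcc, Prod.mk.injEq, Sum.inl.injEq] at h1
      exact ⟨p', hp', h1.1⟩
    have hx1 : x ∈ keySet l (t 1) := ⟨p0, hp0, rfl⟩
    have key : ∃ j : Fin 3, gSet l (fun p => ι (cc 0 p)) (fun p => ι (cc 1 p)) (fun p => ι (cc 2 p))
        = keySet l (fun p => ι (cc j p)) ∧ x ∈ keySet l (t ((j : ℕ) : ZMod 3)) := by
      rcases gSet_cases l (fun p => ι (cc 0 p)) (fun p => ι (cc 1 p)) (fun p => ι (cc 2 p)) with
        ⟨h1, h2⟩ | ⟨h1, h2⟩ | h1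
      · refine ⟨0, h1, ?_⟩
        have h3 : keySet l (t 0) ⊆ keySet l (t 1) := by simpa using hproj _ _ h2
        have h4 : keySet l (t (0 + 1)) ⊆ keySet l (t (1 + 1)) := keySet_rot q 1 _ _ h3
        have h5 : keySet l (t (0 + 2)) ⊆ keySet l (t (1 + 2)) := keySet_rot q 2 _ _ h3
        have e1 : (0 + 1 : ZMod 3) = 1 := by decide
        have e2 : (1 + 1 : ZMod 3) = 0 + 2 := by decide
        have e3 : (1 + 2 : ZMod 3) = ((0 : Fin 3) : ℕ) := by decide
        rw [e1, e2] at h4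
        rw [e3] at h5
        exact h5 (h4 hx1)
      · refine ⟨2, h1, ?_⟩
        have h3 : keySet l (t 2) ⊆ keySet l (t 1) := by simpa using hproj _ _ h2
        have h4 : keySet l (t (2 + 2)) ⊆ keySet l (t (1 + 2)) := keySet_rot q 2 _ _ h3
        have h5 : keySet l (t (2 + 1)) ⊆ keySet l (t (1 + 1)) := keySet_rot q 1 _ _ h3
        have e1 : (2 + 2 : ZMod 3) = 1 := by decide
        have e2 : (1 + 2 : ZMod 3) = 2 + 1 := by decide
        have e3 : (1 + 1 : ZMod 3) = ((2 : Fin 3) : ℕ) := by decide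
        rw [e1, e2] at h4
        rw [e3] at h5
        exact h5 (h4 hx1)
      · exact ⟨1, h1, by simpa using hx1⟩
    obtain ⟨j, hj, p, hp, hpx⟩ := key
    rw [hj] at hsub
    obtain ⟨p', hp', h'⟩ := hsub ⟨p, hp, rfl⟩
    have h1 := hι h'
    apply hx i _ (hNle i) p' hp'
    rw [h1, hcc, ← hpx]

end assembly
end CQA

namespace CQA

section final

variable {n l : ℕ} {Elem Var : Type}

theorem gSet_sub (l : ℕ) (d e f : Fin n → Elem) : gSet l d e f ⊆ keySet l e := by
  rcases gSet_cases l d e f with ⟨h, h'⟩ | ⟨h, h'⟩ | h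
  · rw [h]; exact h'
  · rw [h]; exact h'
  · rw [h]

namespace Tripath

variable {q : Query n Var} {Θ : Set (Fin n → Elem)}

theorem b_mem (T : Tripath l q Θ) (i : Fin T.m) (hi : i ≠ T.root) : T.bFact i ∈ T.blk i := by
  by_cases h1 : i = T.leaf1
  · rw [h1, T.leaf1_blk]; rfl
  by_cases h2 : i = T.leaf2
  · rw [h2, T.leaf2_blk]; rfl
  rw [(T.other_blk i hi h1 h2).2]
  simp

theorem a_mem (T : Tripath l q Θ) (i j : Fin T.m) (h : T.parent j = some i) :
    T.aFact i ∈ T.blk i := by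
  by_cases hr : i = T.root
  · rw [hr, T.root_blk]; rfl
  have h1 : i ≠ T.leaf1 := by rintro rfl; exact T.leaf1_leaf j h
  have h2 : i ≠ T.leaf2 := by rintro rfl; exact T.leaf2_leaf j h
  rw [(T.other_blk i hr h1 h2).2]
  simp

theorem eq_of_keyEq (T : Tripath l q Θ) (i j : Fin T.m) {a b : Fin n → Elem}
    (ha : a ∈ T.blk i) (hb : b ∈ T.blk j) (hab : keyEq l a b) : i = j := by
  apply T.blk_inj
  obtain ⟨x, _, hi⟩ := T.blk_is_block i
  obtain ⟨y, _, hj⟩ := T.blk_is_block j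
  rw [hi] at ha ⊢
  rw [hj] at hb ⊢
  have hxy : keyEq l x y := (ha.2.trans hab).trans hb.2.symm
  ext z
  exact ⟨fun h => ⟨h.1, hxy.symm.trans h.2⟩, fun h => ⟨h.1, hxy.trans h.2⟩⟩

theorem parent_ne (T : Tripath l q Θ) (i j : Fin T.m) (h : T.parent j = some i) : j ≠ i := by
  rintro rfl
  have key : ∀ k, Relation.ReflTransGen (fun x y => T.parent x = some y) j k → k = j := by
    intro k hk
    induction hk with
    | refl => rfl
    | tail _ h2 ih =>
      rw [ih, h] at h2
      exact (Option.some.inj h2).symm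
  have := key _ (T.reach_root j)
  rw [← this, T.parent_root] at h
  simp at h

end Tripath

theorem cnt_zero (z : Fin n → ℤ) (x : Elem) (k : Fin n → Elem) (h : x ∉ keySet l k) :
    cnt l z x k = 0 := by
  classical
  unfold cnt
  refine Finset.sum_eq_zero fun p hp => ?_
  have hp : (p : ℕ) < l := by simpa [KP] using hp
  rw [if_neg (fun h' => h ⟨p, hp, h'⟩), mul_zero]

theorem noFork [Countable Elem] [Infinite Elem] [Countable Var]
    (q : Query n Var) (hq : TwoWayDet l q) (hnf : ¬ AdmitsForkTripath l q Elem)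
    (D : Set (Fin n → Elem)) : NoForkClaim l q D := by
  rintro x ⟨Θ, hΘ, ⟨T⟩⟩ d hd e he f hf hde hef
  by_contra hfd
  apply hnf
  have htri : Sol q Θ T.fc T.dc := by
    by_contra h
    exact hnf ⟨Θ, T.finite, Θ, subset_rfl, T, h⟩
  obtain ⟨hdΘ, heΘ, μ0, h0d, h0e⟩ := T.center_sol1
  obtain ⟨_, hfΘ, μ1, h1e, h1f⟩ := T.center_sol2
  obtain ⟨_, _, μ2, h2f, h2d⟩ := htri
  simp only [Tripath.fc, Tripath.dc] at h2f h2d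
  have hr1 : T.child1 ≠ T.root := by
    intro h; have := T.parent_child1; rw [h, T.parent_root] at this; simp at this
  have hr2 : T.child2 ≠ T.root := by
    intro h; have := T.parent_child2; rw [h, T.parent_root] at this; simp at this
  have md := T.b_mem _ hr1
  have mf := T.b_mem _ hr2
  have me := T.a_mem _ _ T.parent_child1
  have nde : ¬ keyEq l (T.bFact T.child1) (T.aFact T.branch) := fun h =>
    T.parent_ne _ _ T.parent_child1 (T.eq_of_keyEq _ _ md me h)
  have nfe : ¬ keyEq l (T.bFact T.child2) (T.aFact T.branch) := fun h =>
    T.parent_ne _ _ T.parent_child2 (T.eq_of_keyEq _ _ mf me h)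
  have ndf : ¬ keyEq l (T.bFact T.child1) (T.bFact T.child2) := fun h =>
    T.child_ne (T.eq_of_keyEq _ _ md mf h)
  have hu0 : T.aFact T.root ∈ Θ := by
    have hm : T.aFact T.root ∈ ⋃ i, T.blk i :=
      Set.mem_iUnion.2 ⟨T.root, by rw [T.root_blk]; rfl⟩
    exact (Set.ext_iff.1 T.blk_cover _).2 hm
  obtain ⟨x', hx', hx'u⟩ := Set.not_subset.1 T.g_root
  obtain ⟨p0, hp0, rfl⟩ := gSet_sub l _ _ _ hx'
  let tri : Fin 3 → Fin n → Elem := ![T.bFact T.child1, T.aFact T.branch, T.bFact T.child2]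
  let ν : Fin 3 → Var → Elem := ![μ0, μ1, μ2]
  have hνA : ∀ (s : Fin 3) p, ν s (q.1 p) = tri s p := by
    intro s p
    fin_cases s
    · exact h0d p
    · exact h1e p
    · exact h2f p
  have hνB : ∀ (s : Fin 3) p, ν s (q.2 p) = tri (s + 1) p := by
    intro s p
    fin_cases s
    · exact h0e p
    · exact h1f p
    · exact h2d p
  have htriΘ : ∀ s, tri s ∈ Θ := by
    intro s
    fin_cases s
    · exact hdΘ
    · exact heΘ
    · exact hfΘ
  have hdist : ∀ i i' : Fin 3, keyEq l (tri i) (tri i') → i = i' := by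
    intro i i' h
    fin_cases i <;> fin_cases i' <;> first
      | rfl
      | exact absurd h nde
      | exact absurd h.symm nde
      | exact absurd h nfe
      | exact absurd h.symm nfe
      | exact absurd h ndf
      | exact absurd h.symm ndf
  have hνA' : ∀ s : Fin 3, (fun p => ν s (q.1 p)) = tri s := fun s => funext (hνA s)
  have hν : ∀ (s : ZMod 3) p, (show ZMod 3 → Var → Elem from ν) s (q.2 p) =
      (show ZMod 3 → Var → Elem from ν) (s + 1) (q.1 p) := by
    have h : ∀ (s : Fin 3) p, ν s (q.2 p) = ν (s + 1) (q.1 p) :=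
      fun s p => (hνB s p).trans (hνA (s + 1) p).symm
    exact h
  have hconn : ∀ a ∈ qComponent l q D x, ∀ b ∈ qComponent l q D x, qConn l q D a b :=
    fun a ha b hb => (ha.2.symm _ _).trans _ _ _ hb.2
  have hw : HasWalk l q (tri 0) := by
    have := hasWalk_tri (l := l) q ν hν 0
    exact hνA' 0 ▸ this
  have hwalk : ∀ c ∈ qComponent l q D x, HasWalk l q c := fun c hc =>
    (hasWalk_qConn q D (hconn _ (hΘ (htriΘ 0)) c hc)).1 hw
  refine fork_of_data q hq ν hν ?_ p0 hp0 ?_ ![d, e, f] ?_ hde hef hfd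
  · intro i i' h
    have h1 : keyEq l (tri i) (tri i') := by
      rw [← hνA' i, ← hνA' i']; exact h
    exact hdist i i' h1
  · intro z hz δ
    have e1 : (fun p => ν δ (q.1 p)) = tri δ := hνA' δ
    have e2 : ν (1 : Fin 3) (q.1 p0) = T.aFact T.branch p0 := hνA 1 p0
    have e3 : cnt l z (T.aFact T.branch p0) (tri δ) = 0 := by
      rw [cnt_qConn q hz _ D (hconn _ (hΘ (htriΘ δ)) _ (hΘ hu0))]
      exact cnt_zero z _ _ hx'u
    rw [← e1, ← e2] at e3
    exact e3
  · intro i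
    fin_cases i
    · exact hwalk d hd
    · exact hwalk e he
    · exact hwalk f hf

end final
end CQA

/-- component partition for 2way-determined queries without fork-tripath. -/
theorem component_partition (n l : ℕ) (hn : 1 ≤ n) (hl : l ≤ n)
    (Elem Var : Type) [Countable Elem] [Infinite Elem] [Countable Var] [Infinite Var]
    (q : CQA.Query n Var) (hq : CQA.TwoWayDet l q)
    (hnf : ¬ CQA.AdmitsForkTripath l q Elem)
    (D : Set (Fin n → Elem)) (hD : D.Finite) :
    ∃ N : ℕ, ∃ C : Fin N → Set (Fin n → Elem),
      (∀ i, (C i).Nonempty) ∧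
      (∀ i j, i ≠ j → Disjoint (C i) (C j)) ∧
      (⋃ i, C i) = D ∧
      (∀ i, ¬ CQA.ContainsTripath l q (C i) ∨ CQA.CliqueDB l q (C i)) ∧
      (CQA.Certain l q D ↔ ∃ i, CQA.Certain l q (C i)) ∧
      (∀ k, 1 ≤ k → (∃ i, ∅ ∈ CQA.Delta l k q (C i)) → ∅ ∈ CQA.Delta l k q D) ∧
      (CQA.SaturatingMatching l q D → ∀ i, CQA.SaturatingMatching l q (C i)) := by
  exact CQA.partition_main q hq D hD (CQA.noFork q hq hnf D)
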